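/- arXiv:0806.0459 — 2 statements merged into one kernel-verified Lean document; each statement's English description precedes it below -/
import Mathlib

section
/- Let Ψ and Φ¹, …, Φⁿ be Schwartz functions on ℝ^d with Ψ̂ supported in an annulus around 0, let L : ℝ₊ → ℂ be bounded, λ ∈ (ℝ∗)ⁿ, ρ ∈ (0,1]ⁿ, and let f₁, …, f_{n−1} ∈ L^∞ be fixed. Let K(x,z) be the kernel of the linear map f_n ↦ U_{ρ,λ,L}(f₁,…,f_n), namely K(x,z) = ∫₀^∞ ∫_{ℝ^d} Ψ_t(y) ∏_{j=1}^{n−1} (Φ^j_{λ_j t} ∗ f_j)(x − ρ_j λ_j y) · Φ^n_{λ_n t}(x − ρ_n λ_n y − z) L(t) dy dt/t. Then for all multi-indices α, β, |∂_x^α ∂_z^β K(x,z)| ≤ C (|λ_n| / min_i |λ_i|)^{|α|} · |x−z|^{−d−|α|−|β|} · ‖L‖_∞ ∏_j ‖f_j‖_∞, where |λ_n| = max_i |λ_i|; in particular, for α = 0 the bound is uniform in λ and ρ. -/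
open MeasureTheory
open scoped FourierTransform ENNReal NNReal

/-- L¹-normalized dilation `Φ_t(x) = |t|^{-d} Φ(t⁻¹ x)`. -/
noncomputable def dil {d : ℕ} (Φ : EuclideanSpace ℝ (Fin d) → ℂ) (t : ℝ)
    (x : EuclideanSpace ℝ (Fin d)) : ℂ :=
  ((|t| ^ d)⁻¹ : ℝ) • Φ (t⁻¹ • x)

/-- Convolution `Φ_t ∗ f`. -/
noncomputable def convDil {d : ℕ} (Φ : EuclideanSpace ℝ (Fin d) → ℂ) (t : ℝ)
    (f : EuclideanSpace ℝ (Fin d) → ℂ) (x : EuclideanSpace ℝ (Fin d)) : ℂ :=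
  ∫ w, dil Φ t w * f (x - w)

/-- The kernel of `f_n ↦ U_{ρ,λ,L}(f₁,…,f_n)`. -/
noncomputable def modelKernel (d n : ℕ)
    (Ψ : EuclideanSpace ℝ (Fin d) → ℂ) (Φ : Fin (n + 1) → EuclideanSpace ℝ (Fin d) → ℂ)
    (L : ℝ → ℂ) (lam ρ : Fin (n + 1) → ℝ)
    (f : Fin (n + 1) → EuclideanSpace ℝ (Fin d) → ℂ)
    (x z : EuclideanSpace ℝ (Fin d)) : ℂ :=
  ∫ t in Set.Ioi (0 : ℝ),
    (∫ y, dil Ψ t y *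
      (∏ j ∈ Finset.univ.erase (Fin.last n),
        convDil (Φ j) (lam j * t) (f j) (x - (ρ j * lam j) • y)) *
      dil (Φ (Fin.last n)) (lam (Fin.last n) * t)
        (x - (ρ (Fin.last n) * lam (Fin.last n)) • y - z)) * L t / (t : ℂ)

open scoped ContDiff

section Selection

variable {E F : Type*} [NormedAddCommGroup E] [NormedSpace ℝ E]
  [NormedAddCommGroup F] [NormedSpace ℝ F]

/-- Two functions of a real variable which agree frequently near `0`, away from `0`, have the same
derivative there. -/
theorem HasDerivAt.eq_of_frequently_eq {φ ψ : ℝ → F} {a b : F} (hφ : HasDerivAt φ a 0)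
    (hψ : HasDerivAt ψ b 0) (h : ∃ᶠ s in nhdsWithin (0 : ℝ) {0}ᶜ, φ s = ψ s) : a = b := by
  have h0 : φ 0 = ψ 0 := tendsto_nhds_unique_of_frequently_eq
    (hφ.continuousAt.tendsto.mono_left nhdsWithin_le_nhds)
    (hψ.continuousAt.tendsto.mono_left nhdsWithin_le_nhds) h
  refine tendsto_nhds_unique_of_frequently_eq (hasDerivAt_iff_tendsto_slope.1 hφ)
    (hasDerivAt_iff_tendsto_slope.1 hψ) (h.mono fun s hs => ?_)
  simp only [slope, hs, h0]

/-- If `h` takes at each point near `x` either the value `0` or the value of `g`, the same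
alternative holds for the (possibly junk) derivative at `x`. -/
theorem fderiv_eq_zero_or_eq {h g : E → F} {x : E} (hg : DifferentiableAt ℝ g x)
    (hh : ∀ᶠ y in nhds x, h y = 0 ∨ h y = g y) :
    fderiv ℝ h x = 0 ∨ fderiv ℝ h x = fderiv ℝ g x := by
  by_cases hd : DifferentiableAt ℝ h x
  swap
  · exact Or.inl (fderiv_zero_of_not_differentiableAt hd)
  have line : ∀ {k : E → F}, DifferentiableAt ℝ k x → ∀ u : E,
      HasDerivAt (fun s : ℝ => k (x + s • u)) (fderiv ℝ k x u) 0 := by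
    intro k hk u
    have h1 : HasDerivAt (fun s : ℝ => x + s • u) u 0 := by
      simpa using ((hasDerivAt_id (0 : ℝ)).smul_const u).const_add x
    have h2 : HasFDerivAt k (fderiv ℝ k x) (x + (0 : ℝ) • u) := by simpa using hk.hasFDerivAt
    exact h2.comp_hasDerivAt (0 : ℝ) h1
  have key : ∀ u : E, fderiv ℝ h x u = 0 ∨ fderiv ℝ h x u = fderiv ℝ g x u := by
    intro u
    have hev : ∀ᶠ s in nhdsWithin (0 : ℝ) {0}ᶜ,
        h (x + s • u) = 0 ∨ h (x + s • u) = g (x + s • u) := by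
      have ht : Filter.Tendsto (fun s : ℝ => x + s • u) (nhdsWithin (0 : ℝ) {0}ᶜ) (nhds x) := by
        have : ContinuousAt (fun s : ℝ => x + s • u) 0 := by fun_prop
        have h3 := this.tendsto
        simp only [zero_smul, add_zero] at h3
        exact h3.mono_left nhdsWithin_le_nhds
      exact ht.eventually hh
    rcases Filter.frequently_or_distrib.1 hev.frequently with h1 | h1
    · exact Or.inl ((line hd u).eq_of_frequently_eq (hasDerivAt_const 0 (0 : F)) h1)
    · exact Or.inr ((line hd u).eq_of_frequently_eq (line hg u) h1)
  by_contra hcon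
  push Not at hcon
  obtain ⟨hc1, hc2⟩ := hcon
  obtain ⟨u, hu⟩ : ∃ u, fderiv ℝ h x u ≠ 0 := by
    by_contra hne
    push Not at hne
    exact hc1 (ContinuousLinearMap.ext hne)
  obtain ⟨v, hv⟩ : ∃ v, fderiv ℝ h x v ≠ fderiv ℝ g x v := by
    by_contra hne
    push Not at hne
    exact hc2 (ContinuousLinearMap.ext hne)
  have hu' := (key u).resolve_left hu
  have hv' := (key v).resolve_right hv
  rcases key (u + v) with h1 | h1
  · rw [map_add, hv', add_zero] at h1
    exact hu h1
  · rw [map_add, map_add, hu'] at h1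
    exact hv (add_left_cancel h1)

theorem iteratedFDeriv_eq_zero_or_eq {h g : E → F} {U : Set E} (hU : IsOpen U) {n : ℕ}
    (hg : ContDiffOn ℝ n g U) (hh : ∀ x ∈ U, h x = 0 ∨ h x = g x) :
    ∀ x ∈ U, iteratedFDeriv ℝ n h x = 0 ∨ iteratedFDeriv ℝ n h x = iteratedFDeriv ℝ n g x := by
  induction n with
  | zero =>
    intro x hx
    rcases hh x hx with h1 | h1
    · left
      ext m
      simp [h1]
    · right
      ext m
      simp [h1]
  | succ n ih =>
    intro x hx
    have ih' := ih (hg.of_le (by exact_mod_cast n.le_succ))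
    have hd : DifferentiableAt ℝ (iteratedFDeriv ℝ n g) x :=
      (hg.contDiffAt (hU.mem_nhds hx)).differentiableAt_iteratedFDeriv
        (by exact_mod_cast n.lt_succ_self)
    rw [iteratedFDeriv_succ_eq_comp_left, iteratedFDeriv_succ_eq_comp_left]
    rcases fderiv_eq_zero_or_eq hd (Filter.eventually_of_mem (hU.mem_nhds hx) ih') with h1 | h1
    · left
      ext x'
      simp [h1]
    · right
      simp [h1]

end Selection

section Slices

variable {E W F : Type*} [NormedAddCommGroup E] [NormedSpace ℝ E]
  [NormedAddCommGroup W] [NormedSpace ℝ W]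
  [NormedAddCommGroup F] [NormedSpace ℝ F]

theorem norm_iteratedFDeriv_iteratedFDeriv (J : W → F) (a b : ℕ) (x : W) :
    ‖iteratedFDeriv ℝ b (iteratedFDeriv ℝ a J) x‖ = ‖iteratedFDeriv ℝ (a + b) J x‖ := by
  induction b generalizing a with
  | zero => simp
  | succ b ih =>
    rw [← norm_iteratedFDeriv_fderiv]
    have h1 : fderiv ℝ (iteratedFDeriv ℝ a J)
        = (continuousMultilinearCurryLeftEquiv ℝ (fun _ : Fin (a + 1) => W) F) ∘
          iteratedFDeriv ℝ (a + 1) J := by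
      rw [iteratedFDeriv_succ_eq_comp_left]
      ext x
      simp
    rw [h1, LinearIsometryEquiv.norm_iteratedFDeriv_comp_left, ih,
      show a + 1 + b = a + (b + 1) by ring]

theorem iteratedFDeriv_comp_affine {J : W → F} {U : Set W} (hU : IsOpen U)
    (hJ : ContDiffOn ℝ ∞ J U) (A : E →L[ℝ] W) (c : W) (k : ℕ) {x : E} (hx : A x + c ∈ U) :
    iteratedFDeriv ℝ k (fun x' => J (A x' + c)) x
      = (iteratedFDeriv ℝ k J (A x + c)).compContinuousLinearMap (fun _ => A) := by
  have hU' : IsOpen ((fun w => w + c) ⁻¹' U) := hU.preimage (by fun_prop)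
  have hJ' : ContDiffOn ℝ ∞ (fun w => J (w + c)) ((fun w => w + c) ⁻¹' U) :=
    hJ.comp (by fun_prop) (fun w hw => hw)
  have h := A.iteratedFDerivWithin_comp_right hJ' hU'.uniqueDiffOn
    (hU'.preimage A.continuous).uniqueDiffOn (x := x) hx (i := k) (by exact_mod_cast le_top)
  rw [iteratedFDerivWithin_of_isOpen k (hU'.preimage A.continuous) hx,
    iteratedFDerivWithin_of_isOpen k hU' hx, iteratedFDeriv_comp_add_right] at h
  exact h

theorem norm_iteratedFDeriv_comp_affine_le {J : W → F} {U : Set W} (hU : IsOpen U)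
    (hJ : ContDiffOn ℝ ∞ J U) (A : E →L[ℝ] W) (c : W) (k : ℕ) {x : E} (hx : A x + c ∈ U) :
    ‖iteratedFDeriv ℝ k (fun x' => J (A x' + c)) x‖ ≤
      ‖A‖ ^ k * ‖iteratedFDeriv ℝ k J (A x + c)‖ := by
  rw [iteratedFDeriv_comp_affine hU hJ A c k hx]
  refine (ContinuousMultilinearMap.norm_compContinuousLinearMap_le _ _).trans ?_
  simp [mul_comm]

/-- Successive partial derivatives are controlled by the full derivative of the joint function. -/
theorem norm_iteratedFDeriv_slices_le {J : W → F} {U : Set W} (hU : IsOpen U)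
    (hJ : ContDiffOn ℝ ∞ J U) (A B : E →L[ℝ] W) (a b : ℕ) {x z : E} (hx : A x + B z ∈ U) :
    ‖iteratedFDeriv ℝ b (fun z' => iteratedFDeriv ℝ a (fun x' => J (A x' + B z')) x) z‖
      ≤ ‖A‖ ^ a * ‖B‖ ^ b * ‖iteratedFDeriv ℝ (a + b) J (A x + B z)‖ := by
  have hJa : ContDiffOn ℝ ∞ (iteratedFDeriv ℝ a J) U := fun w hw =>
    ((hJ.contDiffAt (hU.mem_nhds hw)).iteratedFDeriv_right (m := ∞) (i := a)
      (by exact_mod_cast le_top)).contDiffWithinAt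
  let T : (W [×a]→L[ℝ] F) →L[ℝ] (E [×a]→L[ℝ] F) :=
    ContinuousMultilinearMap.compContinuousLinearMapL (fun _ : Fin a => A)
  have hT : ‖T‖ ≤ ‖A‖ ^ a := by
    refine (ContinuousMultilinearMap.norm_compContinuousLinearMapL_le F _).trans ?_
    simp
  have hV : IsOpen ((fun z' => B z' + A x) ⁻¹' U) := hU.preimage (by fun_prop)
  have hzV : z ∈ (fun z' => B z' + A x) ⁻¹' U := by simpa [add_comm] using hx
  have heq : (fun z' => iteratedFDeriv ℝ a (fun x' => J (A x' + B z')) x)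
      =ᶠ[nhds z] T ∘ (fun z' => iteratedFDeriv ℝ a J (B z' + A x)) := by
    filter_upwards [hV.mem_nhds hzV] with z' hz'
    rw [iteratedFDeriv_comp_affine hU hJ A (B z') a (by rw [add_comm]; exact hz'), add_comm]
    rfl
  have hcd : ContDiffAt ℝ ∞ (fun z' => iteratedFDeriv ℝ a J (B z' + A x)) z :=
    ContDiffAt.comp z (hJa.contDiffAt (hU.mem_nhds hzV)) (by fun_prop)
  rw [(heq.iteratedFDeriv ℝ b).eq_of_nhds]
  calc _ ≤ ‖T‖ * _ := T.norm_iteratedFDeriv_comp_left hcd (by exact_mod_cast le_top)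
    _ ≤ ‖A‖ ^ a * (‖B‖ ^ b * ‖iteratedFDeriv ℝ b (iteratedFDeriv ℝ a J) (B z + A x)‖) :=
        mul_le_mul hT (norm_iteratedFDeriv_comp_affine_le hU hJa B (A x) b hzV) (norm_nonneg _)
          (by positivity)
    _ = _ := by rw [norm_iteratedFDeriv_iteratedFDeriv, add_comm (B z), mul_assoc]

end Slices

section ParametricIntegral

variable {X V F : Type*} [MeasurableSpace X] {μ : Measure X}
  [NormedAddCommGroup V] [NormedSpace ℝ V] [FiniteDimensional ℝ V]
  [NormedAddCommGroup F] [NormedSpace ℝ F]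

theorem aestronglyMeasurable_fderiv {f : X → V → F} {U : Set V} (hU : IsOpen U)
    (hmeas : ∀ v ∈ U, AEStronglyMeasurable (fun a => f a v) μ) {v : V} (hv : v ∈ U)
    (hd : ∀ᵐ a ∂μ, DifferentiableAt ℝ (f a) v) :
    AEStronglyMeasurable (fun a => fderiv ℝ (f a) v) μ := by
  classical
  have happ : ∀ e : V, AEStronglyMeasurable (fun a => fderiv ℝ (f a) v e) μ := by
    intro e
    have ht : Filter.Tendsto (fun n : ℕ => v + ((n : ℝ) + 1)⁻¹ • e) Filter.atTop (nhds v) := by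
      have h1 : Filter.Tendsto (fun n : ℕ => ((n : ℝ) + 1)⁻¹) Filter.atTop (nhds 0) := by
        simpa using tendsto_one_div_add_atTop_nhds_zero_nat (𝕜 := ℝ)
      simpa using (h1.smul_const e).const_add v
    obtain ⟨N, hN⟩ := Filter.eventually_atTop.1 (ht.eventually (hU.mem_nhds hv))
    refine aestronglyMeasurable_of_tendsto_ae Filter.atTop
      (f := fun n : ℕ => fun a => (((n + N : ℕ) : ℝ) + 1) •
        (f a (v + (((n + N : ℕ) : ℝ) + 1)⁻¹ • e) - f a v)) (fun n => ?_) ?_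
    · exact ((hmeas _ (hN _ (Nat.le_add_left N n))).sub (hmeas v hv)).const_smul _
    · filter_upwards [hd] with a ha
      have hl : HasDerivAt (fun s : ℝ => f a (v + s • e)) (fderiv ℝ (f a) v e) 0 := by
        have h1 : HasDerivAt (fun s : ℝ => v + s • e) e 0 := by
          simpa using ((hasDerivAt_id (0 : ℝ)).smul_const e).const_add v
        have h2 : HasFDerivAt (f a) (fderiv ℝ (f a) v) (v + (0 : ℝ) • e) := by
          simpa using ha.hasFDerivAt
        exact h2.comp_hasDerivAt (0 : ℝ) h1
      have h1 : Filter.Tendsto (fun n : ℕ => (((n + N : ℕ) : ℝ) + 1)⁻¹) Filter.atTop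
          (nhdsWithin 0 {0}ᶜ) := by
        refine tendsto_nhdsWithin_iff.2 ⟨?_, Filter.Eventually.of_forall fun n => ?_⟩
        · have h2 : Filter.Tendsto (fun n : ℕ => ((n : ℝ) + 1)⁻¹) Filter.atTop (nhds 0) := by
            simpa using tendsto_one_div_add_atTop_nhds_zero_nat (𝕜 := ℝ)
          exact h2.comp (Filter.tendsto_add_atTop_nat N)
        · have : (((n + N : ℕ) : ℝ) + 1)⁻¹ ≠ 0 := by positivity
          simpa using this
      refine ((hasDerivAt_iff_tendsto_slope.1 hl).comp h1).congr fun n => ?_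
      simp [slope]
  let bs := Module.finBasis ℝ V
  have hrep : ∀ T : V →L[ℝ] F, T = ∑ i, (LinearMap.toContinuousLinearMap (bs.coord i)).smulRight
      (T (bs i)) := by
    intro T
    ext e
    have h1 : T e = T (∑ i, bs.repr e i • bs i) := by rw [bs.sum_repr]
    rw [h1, map_sum]
    simp
  have : (fun a => fderiv ℝ (f a) v) = fun a => ∑ i,
      (LinearMap.toContinuousLinearMap (bs.coord i)).smulRight (fderiv ℝ (f a) v (bs i)) := by
    ext1 a
    exact hrep _
  rw [this]
  refine Finset.aestronglyMeasurable_fun_sum _ fun i _ => ?_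
  have hc : Continuous (fun w : F => (LinearMap.toContinuousLinearMap (bs.coord i)).smulRight w) :=
    (ContinuousLinearMap.smulRightL ℝ V F (LinearMap.toContinuousLinearMap (bs.coord i))).continuous
  exact hc.comp_aestronglyMeasurable (happ (bs i))

theorem aestronglyMeasurable_iteratedFDeriv {f : X → V → F} {U : Set V} (hU : IsOpen U)
    (hsm : ∀ᵐ a ∂μ, ContDiffOn ℝ ∞ (f a) U)
    (hmeas : ∀ v ∈ U, AEStronglyMeasurable (fun a => f a v) μ) (k : ℕ) :
    ∀ v ∈ U, AEStronglyMeasurable (fun a => iteratedFDeriv ℝ k (f a) v) μ := by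
  induction k with
  | zero =>
    intro v hv
    exact (continuousMultilinearCurryFin0 ℝ V F).symm.continuous.comp_aestronglyMeasurable
      (hmeas v hv)
  | succ k ih =>
    intro v hv
    simp_rw [iteratedFDeriv_succ_eq_comp_left]
    refine (LinearIsometryEquiv.continuous _).comp_aestronglyMeasurable
      (aestronglyMeasurable_fderiv hU ih hv ?_)
    filter_upwards [hsm] with a ha
    exact (ha.contDiffAt (hU.mem_nhds hv)).differentiableAt_iteratedFDeriv
      (by exact_mod_cast ENat.natCast_lt_top k)

/-- Differentiation under the integral sign, for derivatives of all orders. -/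
theorem contDiffOn_integral_of_dominated [CompleteSpace F] {f : X → V → F} {U : Set V}
    (hU : IsOpen U) (hsm : ∀ᵐ a ∂μ, ContDiffOn ℝ ∞ (f a) U)
    (hmeas : ∀ v ∈ U, AEStronglyMeasurable (fun a => f a v) μ)
    (hdom : ∀ k : ℕ, ∀ v ∈ U, ∃ s ∈ nhds v, ∃ bound : X → ℝ, Integrable bound μ ∧
      ∀ᵐ a ∂μ, ∀ v' ∈ s, ‖iteratedFDeriv ℝ k (f a) v'‖ ≤ bound a) :
    ContDiffOn ℝ ∞ (fun v => ∫ a, f a v ∂μ) U ∧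
      ∀ k : ℕ, ∀ v ∈ U, iteratedFDeriv ℝ k (fun v => ∫ a, f a v ∂μ) v
        = ∫ a, iteratedFDeriv ℝ k (f a) v ∂μ := by
  have hM := aestronglyMeasurable_iteratedFDeriv hU hsm hmeas
  have hI : ∀ k : ℕ, ∀ v ∈ U, Integrable (fun a => iteratedFDeriv ℝ k (f a) v) μ := by
    intro k v hv
    obtain ⟨s, hs, bound, hb, hbd⟩ := hdom k v hv
    refine hb.mono' (hM k v hv) ?_
    filter_upwards [hbd] with a ha using ha v (mem_of_mem_nhds hs)
  have hdiff : ∀ a, ContDiffOn ℝ ∞ (f a) U → ∀ k : ℕ, ∀ v ∈ U,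
      DifferentiableAt ℝ (iteratedFDeriv ℝ k (f a)) v := fun a ha k v hv =>
    (ha.contDiffAt (hU.mem_nhds hv)).differentiableAt_iteratedFDeriv
      (by exact_mod_cast ENat.natCast_lt_top k)
  have hder : ∀ k : ℕ, ∀ v ∈ U, HasFDerivAt (fun v => ∫ a, iteratedFDeriv ℝ k (f a) v ∂μ)
      (∫ a, fderiv ℝ (iteratedFDeriv ℝ k (f a)) v ∂μ) v := by
    intro k v hv
    obtain ⟨s, hs, bound, hb, hbd⟩ := hdom (k + 1) v hv
    refine hasFDerivAt_integral_of_dominated_of_fderiv_le (s := s ∩ U) (bound := bound)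
      (F' := fun v a => fderiv ℝ (iteratedFDeriv ℝ k (f a)) v)
      (Filter.inter_mem hs (hU.mem_nhds hv))
      (Filter.eventually_of_mem (hU.mem_nhds hv) (hM k)) (hI k v hv) ?_ ?_ hb ?_
    · refine aestronglyMeasurable_fderiv hU (hM k) hv ?_
      filter_upwards [hsm] with a ha using hdiff a ha k v hv
    · filter_upwards [hbd] with a ha v' hv'
      rw [norm_fderiv_iteratedFDeriv]
      exact ha v' hv'.1
    · filter_upwards [hsm] with a ha v' hv' using (hdiff a ha k v' hv'.2).hasFDerivAt
  have hform : ∀ k : ℕ, ∀ v ∈ U, iteratedFDeriv ℝ k (fun v => ∫ a, f a v ∂μ) v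
      = ∫ a, iteratedFDeriv ℝ k (f a) v ∂μ := by
    intro k
    induction k with
    | zero =>
      intro v hv
      simp only [iteratedFDeriv_zero_eq_comp, Function.comp_apply]
      exact ((continuousMultilinearCurryFin0 ℝ V F).symm.toContinuousLinearEquiv.integral_comp_comm
        (fun a => f a v)).symm
    | succ k ih =>
      intro v hv
      have h1 : fderiv ℝ (iteratedFDeriv ℝ k (fun v => ∫ a, f a v ∂μ)) v
          = ∫ a, fderiv ℝ (iteratedFDeriv ℝ k (f a)) v ∂μ := by
        rw [← (hder k v hv).fderiv]
        exact Filter.EventuallyEq.fderiv_eq (Filter.eventually_of_mem (hU.mem_nhds hv) ih)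
      simp only [iteratedFDeriv_succ_eq_comp_left, Function.comp_apply, h1]
      let S : (V →L[ℝ] (V [×k]→L[ℝ] F)) ≃L[ℝ] (V [×(k + 1)]→L[ℝ] F) :=
        (continuousMultilinearCurryLeftEquiv ℝ (fun _ : Fin (k + 1) => V)
          F).symm.toContinuousLinearEquiv
      exact (ContinuousLinearEquiv.integral_comp_comm (𝕜 := ℝ) S
        (fun a => fderiv ℝ (iteratedFDeriv ℝ k (f a)) v)).symm
  refine ⟨contDiffOn_of_differentiableOn fun m _ => ?_, hform⟩
  intro v hv
  refine DifferentiableAt.differentiableWithinAt ?_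
  refine (hder m v hv).differentiableAt.congr_of_eventuallyEq ?_
  filter_upwards [hU.mem_nhds hv] with v' hv'
  rw [iteratedFDerivWithin_of_isOpen m hU hv', hform m v' hv']

end ParametricIntegral

section SliceSelection

variable {E W F : Type*} [NormedAddCommGroup E] [NormedSpace ℝ E]
  [NormedAddCommGroup W] [NormedSpace ℝ W]
  [NormedAddCommGroup F] [NormedSpace ℝ F]

theorem contDiffOn_iteratedFDeriv_slice {J : W → F} {U : Set W} (hU : IsOpen U)
    (hJ : ContDiffOn ℝ ∞ J U) (A B : E →L[ℝ] W) (a : ℕ) (x : E) :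
    ContDiffOn ℝ ∞ (fun z => iteratedFDeriv ℝ a (fun x' => J (A x' + B z)) x)
      {z | A x + B z ∈ U} := by
  have hJa : ContDiffOn ℝ ∞ (iteratedFDeriv ℝ a J) U := fun w hw =>
    ((hJ.contDiffAt (hU.mem_nhds hw)).iteratedFDeriv_right (m := ∞) (i := a)
      (by exact_mod_cast le_top)).contDiffWithinAt
  let T : (W [×a]→L[ℝ] F) →L[ℝ] (E [×a]→L[ℝ] F) :=
    ContinuousMultilinearMap.compContinuousLinearMapL (fun _ : Fin a => A)
  have h : ContDiffOn ℝ ∞ (fun z => T (iteratedFDeriv ℝ a J (A x + B z))) {z | A x + B z ∈ U} :=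
    T.contDiff.comp_contDiffOn (hJa.comp (by fun_prop) fun z hz => hz)
  exact h.congr fun z hz => iteratedFDeriv_comp_affine hU hJ A (B z) a hz

/-- If `h x z` is, for each `(x, z)`, either `0` or the value of a smooth function of a linear
image of `(x, z)`, then its (possibly junk) iterated partial derivatives are controlled by the
derivatives of that smooth function. -/
theorem norm_iteratedFDeriv_slices_le_of_eq_zero_or_eq {J : W → F} {U : Set W} (hU : IsOpen U)
    (hJ : ContDiffOn ℝ ∞ J U) (A B : E →L[ℝ] W) {h : E → E → F}
    (hh : ∀ x z, A x + B z ∈ U → h x z = 0 ∨ h x z = J (A x + B z)) (a b : ℕ) {x z : E}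
    (hx : A x + B z ∈ U) :
    ‖iteratedFDeriv ℝ b (fun z' => iteratedFDeriv ℝ a (fun x' => h x' z') x) z‖
      ≤ ‖A‖ ^ a * ‖B‖ ^ b * ‖iteratedFDeriv ℝ (a + b) J (A x + B z)‖ := by
  have h1 : ∀ z', A x + B z' ∈ U → iteratedFDeriv ℝ a (fun x' => h x' z') x = 0 ∨
      iteratedFDeriv ℝ a (fun x' => h x' z') x
        = iteratedFDeriv ℝ a (fun x' => J (A x' + B z')) x := by
    intro z' hz'
    refine iteratedFDeriv_eq_zero_or_eq (U := {x' | A x' + B z' ∈ U})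
      (hU.preimage (by fun_prop)) ?_ (fun x' hx' => hh x' z' hx') x hz'
    have hJc : ContDiffOn ℝ ∞ (fun x' => J (A x' + B z')) {x' | A x' + B z' ∈ U} :=
      hJ.comp (by fun_prop) fun x' hx' => hx'
    exact hJc.of_le (by exact_mod_cast le_top)
  have h2 := iteratedFDeriv_eq_zero_or_eq (U := {z' | A x + B z' ∈ U}) (n := b)
    (hU.preimage (by fun_prop))
    ((contDiffOn_iteratedFDeriv_slice hU hJ A B a x).of_le (by exact_mod_cast le_top)) h1 z hx
  rcases h2 with h2 | h2
  · rw [h2, norm_zero]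
    positivity
  · rw [h2]
    exact norm_iteratedFDeriv_slices_le hU hJ A B a b hx

end SliceSelection

section BandLimited

variable {E : Type*} [NormedAddCommGroup E] [InnerProductSpace ℝ E] [FiniteDimensional ℝ E]
  [MeasurableSpace E] [BorelSpace E]

/-- A continuous function which is nonzero at almost every point of almost every line through a
given point is nonzero almost everywhere. -/
theorem ae_ne_zero_of_ae_lines {Φ : E → ℂ} (hc : Continuous Φ) (x : E)
    (h : ∀ v : E, ∀ᵐ r : ℝ, Φ (x + r • v) ≠ 0) : ∀ᵐ v : E, Φ v ≠ 0 := by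
  have hmeas : MeasurableSet {p : E × ℝ | Φ (x + p.2 • p.1) ≠ 0} := by
    have : Continuous fun p : E × ℝ => Φ (x + p.2 • p.1) := by fun_prop
    exact (isOpen_ne.preimage this).measurableSet
  have h1 : ∀ᵐ r : ℝ, ∀ᵐ v : E, Φ (x + r • v) ≠ 0 :=
    (Measure.ae_ae_comm (p := fun (v : E) (r : ℝ) => Φ (x + r • v) ≠ 0) hmeas).1
      (Filter.Eventually.of_forall h)
  have h2 : ∀ᵐ r : ℝ, r ≠ 0 := by
    simp [ae_iff]
  obtain ⟨r, hr, hr0⟩ := (h1.and h2).exists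
  rw [ae_iff] at hr ⊢
  have h3 : {v : E | ¬ Φ (x + r • v) ≠ 0}
      = (fun v => r • v) ⁻¹' ((fun v => x + v) ⁻¹' {v | ¬ Φ v ≠ 0}) := rfl
  rw [h3, Measure.addHaar_preimage_smul _ hr0, measure_preimage_add, mul_eq_zero] at hr
  refine hr.resolve_left ?_
  simp [hr0]

/-- A Schwartz function whose Fourier transform is supported in a ball restricts to each line as
the trace of an entire function. -/
theorem exists_entire_eq_on_line (Φ : SchwartzMap E ℂ) {R : ℝ} (hR : 0 < R)
    (hΦ : ∀ ξ : E, R < ‖ξ‖ → 𝓕 (fun x => Φ x) ξ = 0) (x v : E) :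
    ∃ G : ℂ → ℂ, Differentiable ℂ G ∧ ∀ r : ℝ, G r = Φ (x + r • v) := by
  set g : SchwartzMap E ℂ := 𝓕 Φ with hg
  have hg0 : ∀ ξ, R < ‖ξ‖ → g ξ = 0 := hΦ
  let c : E → ℂ → ℂ := fun ξ ζ =>
    2 * Real.pi * Complex.I * ((inner ℝ ξ x : ℝ) + ζ * (inner ℝ ξ v : ℝ))
  refine ⟨fun ζ => ∫ ξ, Complex.exp (c ξ ζ) * g ξ, ?_, ?_⟩
  · intro ζ₀
    have hcont : ∀ ζ, Continuous fun ξ => Complex.exp (c ξ ζ) * g ξ := by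
      intro ζ
      have := g.continuous
      fun_prop
    have hre : ∀ ξ ζ, (c ξ ζ).re = -(2 * Real.pi * (ζ.im * inner ℝ ξ v)) := by
      intro ξ ζ
      simp only [c]
      simp
    set A : ℝ := Real.exp (2 * Real.pi * ((‖ζ₀‖ + 1) * (R * ‖v‖))) with hA
    have hexp : ∀ ξ, ∀ ζ ∈ Metric.ball ζ₀ 1, ‖Complex.exp (c ξ ζ) * g ξ‖ ≤ A * ‖g ξ‖ := by
      intro ξ ζ hζ
      rcases lt_or_ge R ‖ξ‖ with h1 | h1
      · simp [hg0 ξ h1]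
      rw [norm_mul, Complex.norm_exp, hre, hA, ← mul_neg]
      gcongr
      have h2 : ‖ζ‖ ≤ ‖ζ₀‖ + 1 := by
        have := norm_sub_norm_le ζ ζ₀
        have h3 : ‖ζ - ζ₀‖ < 1 := by simpa [dist_eq_norm] using hζ
        linarith
      calc -(ζ.im * inner ℝ ξ v) ≤ |ζ.im * inner ℝ ξ v| := neg_le_abs _
        _ = |ζ.im| * |inner ℝ ξ v| := abs_mul _ _
        _ ≤ (‖ζ₀‖ + 1) * (R * ‖v‖) := by
          gcongr
          · exact (Complex.abs_im_le_norm ζ).trans h2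
          · exact (abs_real_inner_le_norm ξ v).trans (by gcongr)
    have hI : Integrable (fun ξ => A * ‖g ξ‖) := g.integrable.norm.const_mul A
    refine (hasDerivAt_integral_of_dominated_loc_of_deriv_le
      (F := fun ζ ξ => Complex.exp (c ξ ζ) * g ξ)
      (F' := fun ζ ξ => (2 * Real.pi * Complex.I * (inner ℝ ξ v : ℝ)) *
        (Complex.exp (c ξ ζ) * g ξ))
      (bound := fun ξ => (2 * Real.pi * (R * ‖v‖)) * (A * ‖g ξ‖))
      (Metric.ball_mem_nhds ζ₀ one_pos)
      (Filter.Eventually.of_forall fun ζ => (hcont ζ).aestronglyMeasurable)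
      (hI.mono' (hcont ζ₀).aestronglyMeasurable (Filter.Eventually.of_forall fun ξ =>
        hexp ξ ζ₀ (Metric.mem_ball_self one_pos))) ?_ ?_ (hI.const_mul _) ?_).2.differentiableAt
    · have := g.continuous
      refine Continuous.aestronglyMeasurable ?_
      fun_prop
    · refine Filter.Eventually.of_forall fun ξ ζ hζ => ?_
      rcases lt_or_ge R ‖ξ‖ with h1 | h1
      · simp [hg0 ξ h1]
      rw [norm_mul]
      refine mul_le_mul ?_ (hexp ξ ζ hζ) (norm_nonneg _) (by positivity)
      have h2 : |inner ℝ ξ v| ≤ R * ‖v‖ := (abs_real_inner_le_norm ξ v).trans (by gcongr)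
      simp only [norm_mul, Complex.norm_I, Complex.norm_real, Complex.norm_ofNat, Real.norm_eq_abs,
        abs_of_pos Real.pi_pos, mul_one]
      gcongr
    · refine Filter.Eventually.of_forall fun ξ ζ _ => ?_
      have h1 : HasDerivAt (c ξ) (2 * Real.pi * Complex.I * (inner ℝ ξ v : ℝ)) ζ := by
        have := (((hasDerivAt_id ζ).mul_const ((inner ℝ ξ v : ℝ) : ℂ)).const_add
          ((inner ℝ ξ x : ℝ) : ℂ)).const_mul (2 * Real.pi * Complex.I)
        simpa using this
      have h2 := h1.cexp.mul_const (g ξ)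
      exact h2.congr_deriv ((mul_assoc _ _ _).trans (mul_left_comm _ _ _))
  · intro r
    have h1 : Φ (x + r • v) = (𝓕⁻ g) (x + r • v) := by
      rw [hg, FourierTransform.fourierInv_fourier_eq]
    rw [h1, SchwartzMap.fourierInv_coe, Real.fourierInv_eq']
    refine integral_congr_ae (Filter.Eventually.of_forall fun ξ => ?_)
    simp only [smul_eq_mul, c, inner_add_right, inner_smul_right]
    congr 2
    push_cast
    ring

theorem ae_ne_zero_of_fourier_eq_zero (Φ : SchwartzMap E ℂ) {R : ℝ} (hR : 0 < R)
    (hΦ : ∀ ξ : E, R < ‖ξ‖ → 𝓕 (fun x => Φ x) ξ = 0) (h0 : Φ ≠ 0) : ∀ᵐ v : E, Φ v ≠ 0 := by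
  obtain ⟨x, hx⟩ : ∃ x, Φ x ≠ 0 := by
    by_contra hne
    push Not at hne
    exact h0 (by ext x; simp [hne x])
  refine ae_ne_zero_of_ae_lines Φ.continuous x fun v => ?_
  obtain ⟨G, hG, hGΦ⟩ := exists_entire_eq_on_line Φ hR hΦ x v
  have han : AnalyticOnNhd ℝ (fun r : ℝ => G r) Set.univ := fun r _ =>
    ((hG.analyticAt (r : ℂ)).restrictScalars (𝕜 := ℝ)).comp
      (Complex.ofRealCLM.analyticAt r)
  have h1 : G ((0 : ℝ) : ℂ) ≠ 0 := by rw [hGΦ]; simpa using hx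
  have h2 := han.preimage_zero_mem_codiscrete (x := 0) h1
  have h3 : ∀ᵐ r : ℝ, G (r : ℂ) ≠ 0 := by
    have := ae_restrict_le_codiscreteWithin (μ := (volume : Measure ℝ)) MeasurableSet.univ h2
    rw [Measure.restrict_univ] at this
    exact this
  filter_upwards [h3] with r hr
  rwa [hGΦ] at hr

end BandLimited

theorem inv_one_add_norm_sub_pow_le {E : Type*} [SeminormedAddCommGroup E] (a b : E) (N : ℕ) :
    ((1 + ‖a - b‖) ^ N)⁻¹ ≤ (1 + ‖b‖) ^ N * ((1 + ‖a‖) ^ N)⁻¹ := by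
  have h : 1 + ‖a‖ ≤ (1 + ‖a - b‖) * (1 + ‖b‖) := by
    have h1 : ‖a‖ ≤ ‖a - b‖ + ‖b‖ := by simpa using norm_add_le (a - b) b
    nlinarith [norm_nonneg (a - b), norm_nonneg b, mul_nonneg (norm_nonneg (a - b)) (norm_nonneg b)]
  have h2 : (1 + ‖a‖) ^ N ≤ (1 + ‖a - b‖) ^ N * (1 + ‖b‖) ^ N := by
    rw [← mul_pow]
    gcongr
  rw [inv_le_iff_one_le_mul₀ (by positivity), ← div_eq_mul_inv, div_mul_eq_mul_div,
    one_le_div (by positivity), mul_comm]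
  exact h2

section PointwiseBounds

variable {E V : Type*} [NormedAddCommGroup E] [NormedSpace ℝ E]
  [NormedAddCommGroup V] [NormedSpace ℝ V]

theorem SchwartzMap.exists_norm_iteratedFDeriv_le (Φ : SchwartzMap E ℂ) (N k : ℕ) :
    ∃ C : ℝ, 0 ≤ C ∧ ∀ v, ‖iteratedFDeriv ℝ k Φ v‖ ≤ C * ((1 + ‖v‖) ^ N)⁻¹ := by
  refine ⟨2 ^ N * ((Finset.Iic (N, k)).sup fun m => SchwartzMap.seminorm ℝ m.1 m.2) Φ,
    by positivity, fun v => ?_⟩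
  rw [← div_eq_mul_inv, le_div_iff₀ (by positivity), mul_comm]
  exact SchwartzMap.one_add_le_sup_seminorm_apply (𝕜 := ℝ) (m := (N, k)) le_rfl le_rfl Φ v

theorem norm_iteratedFDeriv_comp_sub_le {b : E → ℂ} (hb : ContDiff ℝ ∞ b) {l : V →L[ℝ] E}
    (hl : ‖l‖ ≤ 2) (a : E) (k : ℕ) (p : V) :
    ‖iteratedFDeriv ℝ k (fun p => b (l p - a)) p‖ ≤ 2 ^ k * ‖iteratedFDeriv ℝ k b (l p - a)‖ := by
  have h := norm_iteratedFDeriv_comp_affine_le isOpen_univ hb.contDiffOn l (-a) k (x := p) trivial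
  simp only [← sub_eq_add_neg] at h
  exact h.trans (by gcongr)

theorem exists_norm_iteratedFDeriv_prod_le {ι : Type*} (s : Finset ι)
    (c : ι → ℕ → ℝ) (hc : ∀ j i, 0 ≤ c j i) (k : ℕ) :
    ∃ C : ℝ, 0 ≤ C ∧ ∀ (b : ι → V → ℂ) (B : ι → ℝ), (∀ j ∈ s, ContDiff ℝ ∞ (b j)) →
      (∀ j ∈ s, ∀ i v, ‖iteratedFDeriv ℝ i (b j) v‖ ≤ c j i * B j) →
      ∀ v, ‖iteratedFDeriv ℝ k (fun v => ∏ j ∈ s, b j v) v‖ ≤ C * ∏ j ∈ s, B j := by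
  classical
  refine ⟨∑ p ∈ s.sym k, ((p : Multiset ι).countPerms : ℝ) *
    ∏ j ∈ s, c j (Multiset.count j (p : Multiset ι)), ?_, fun b B hb hbd v => ?_⟩
  · exact Finset.sum_nonneg fun p _ => mul_nonneg (Nat.cast_nonneg _)
      (Finset.prod_nonneg fun j _ => hc j _)
  · refine (norm_iteratedFDeriv_prod_le hb (by exact_mod_cast le_top)).trans ?_
    rw [Finset.sum_mul]
    refine Finset.sum_le_sum fun p _ => ?_
    rw [mul_assoc, ← Finset.prod_mul_distrib]
    refine mul_le_mul_of_nonneg_left ?_ (Nat.cast_nonneg _)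
    exact Finset.prod_le_prod (fun _ _ => norm_nonneg _) fun j hj => hbd j hj _ v

theorem exists_norm_iteratedFDeriv_prod_mul_le {ι : Type*} (s : Finset ι) (Φ : SchwartzMap E ℂ)
    (c : ι → ℕ → ℝ) (hc : ∀ j i, 0 ≤ c j i) (k N : ℕ) :
    ∃ C : ℝ, 0 ≤ C ∧ ∀ (b : ι → E → ℂ) (B : ι → ℝ), (∀ j ∈ s, ContDiff ℝ ∞ (b j)) →
      (∀ j ∈ s, 0 ≤ B j) →
      (∀ j ∈ s, ∀ i v, ‖iteratedFDeriv ℝ i (b j) v‖ ≤ c j i * B j) →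
      ∀ (l : ι → V →L[ℝ] E) (m : V →L[ℝ] E), (∀ j ∈ s, ‖l j‖ ≤ 2) → ‖m‖ ≤ 2 →
      ∀ (a : ι → E) (e : E) (p : V),
        ‖iteratedFDeriv ℝ k (fun p => (∏ j ∈ s, b j (l j p - a j)) * Φ (m p - e)) p‖
          ≤ C * (∏ j ∈ s, B j) * ((1 + ‖m p - e‖) ^ N)⁻¹ := by
  choose C hC0 hC using fun i => exists_norm_iteratedFDeriv_prod_le (V := V) s
    (fun j i => 2 ^ i * c j i) (fun j i => mul_nonneg (by positivity) (hc j i)) i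
  choose D hD0 hD using Φ.exists_norm_iteratedFDeriv_le N
  refine ⟨∑ i ∈ Finset.range (k + 1), (k.choose i : ℝ) * C i * (2 ^ (k - i) * D (k - i)),
    Finset.sum_nonneg fun i _ => mul_nonneg (mul_nonneg (Nat.cast_nonneg _) (hC0 i))
      (mul_nonneg (by positivity) (hD0 _)), ?_⟩
  intro b B hb hB hbd l m hl hm a e p
  have h1 : ∀ j ∈ s, ContDiff ℝ ∞ fun p => b j (l j p - a j) := fun j hj =>
    (hb j hj).comp (by fun_prop)
  have h2 : ContDiff ℝ ∞ fun p => Φ (m p - e) := (Φ.smooth ⊤).comp (by fun_prop)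
  refine (norm_iteratedFDeriv_mul_le (contDiff_prod h1) h2 p (by exact_mod_cast le_top)).trans ?_
  rw [Finset.sum_mul, Finset.sum_mul]
  refine Finset.sum_le_sum fun i _ => ?_
  have h3 := hC i (fun j p => b j (l j p - a j)) B h1 (fun j hj i' v =>
    (norm_iteratedFDeriv_comp_sub_le (hb j hj) (hl j hj) _ _ _).trans (by
      rw [mul_assoc]
      exact mul_le_mul_of_nonneg_left (hbd j hj _ _) (by positivity))) p
  have h4 := (norm_iteratedFDeriv_comp_sub_le (Φ.smooth ⊤) hm e (k - i) p).trans
    (mul_le_mul_of_nonneg_left (hD (k - i) (m p - e)) (by positivity))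
  have hP : 0 ≤ ∏ j ∈ s, B j := Finset.prod_nonneg hB
  calc _ ≤ (k.choose i : ℝ) * (C i * ∏ j ∈ s, B j) *
        (2 ^ (k - i) * (D (k - i) * ((1 + ‖m p - e‖) ^ N)⁻¹)) := by
        refine mul_le_mul (mul_le_mul_of_nonneg_left h3 (Nat.cast_nonneg _)) h4 (norm_nonneg _) ?_
        exact mul_nonneg (Nat.cast_nonneg _) (mul_nonneg (hC0 i) hP)
    _ = _ := by ring

end PointwiseBounds

section SchwartzAverages

variable {E V : Type*} [NormedAddCommGroup E] [InnerProductSpace ℝ E] [FiniteDimensional ℝ E]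
  [MeasurableSpace E] [BorelSpace E]
  [NormedAddCommGroup V] [NormedSpace ℝ V]

theorem integrable_inv_one_add_norm_pow :
    Integrable fun v : E => ((1 + ‖v‖) ^ (Module.finrank ℝ E + 1))⁻¹ := by
  have h := integrable_one_add_norm (E := E) (μ := volume) (r := (Module.finrank ℝ E + 1 : ℕ))
    (by exact_mod_cast Nat.lt_succ_self _)
  refine h.congr (Filter.Eventually.of_forall fun v => ?_)
  simp only
  rw [Real.rpow_neg (by positivity), Real.rpow_natCast]

/-- The convolution of a Schwartz function with a bounded function is smooth, with bounded
derivatives. -/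
theorem SchwartzMap.contDiff_integral_sub_mul (Φ : SchwartzMap E ℂ) {g : E → ℂ}
    (hg : Measurable g) {B : ℝ} (hB : ∀ w, ‖g w‖ ≤ B) :
    ContDiff ℝ ∞ (fun v => ∫ w, g w * Φ (v - w)) ∧
      ∀ k v, iteratedFDeriv ℝ k (fun v => ∫ w, g w * Φ (v - w)) v
        = ∫ w, g w • iteratedFDeriv ℝ k Φ (v - w) := by
  have hD : ∀ w k v, iteratedFDeriv ℝ k (fun v => g w * Φ (v - w)) v
      = g w • iteratedFDeriv ℝ k Φ (v - w) := by
    intro w k v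
    have h1 : ContDiff ℝ ∞ fun v => Φ (v - w) := (Φ.smooth ⊤).comp (by fun_prop)
    have h2 := iteratedFDeriv_const_smul_apply (𝕜 := ℝ) (i := k) (a := g w) (x := v)
      (f := fun v => Φ (v - w)) ((h1.of_le (by exact_mod_cast le_top)).contDiffAt)
    rw [iteratedFDeriv_comp_sub] at h2
    exact h2
  have h := contDiffOn_integral_of_dominated (μ := (volume : Measure E))
    (f := fun w v => g w * Φ (v - w)) isOpen_univ
    (Filter.Eventually.of_forall fun w => by
      have h1 : ContDiff ℝ ∞ fun v => Φ (v - w) := (Φ.smooth ⊤).comp (by fun_prop)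
      exact (contDiff_const.mul h1).contDiffOn)
    (fun v _ => by
      have := Φ.continuous
      exact (hg.mul (by fun_prop : Continuous fun w => Φ (v - w)).measurable).aestronglyMeasurable)
    (fun k v _ => by
      obtain ⟨C, hC0, hC⟩ := Φ.exists_norm_iteratedFDeriv_le (Module.finrank ℝ E + 1) k
      refine ⟨Metric.ball v 1, Metric.ball_mem_nhds v one_pos, fun w => B * (C *
        (2 ^ (Module.finrank ℝ E + 1) * ((1 + ‖v - w‖) ^ (Module.finrank ℝ E + 1))⁻¹)), ?_, ?_⟩
      · refine (Integrable.const_mul ?_ _).const_mul B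
        exact (integrable_inv_one_add_norm_pow.comp_sub_left v).const_mul _
      · refine Filter.Eventually.of_forall fun w v' hv' => ?_
        rw [hD, norm_smul]
        have hB0 : 0 ≤ B := (norm_nonneg _).trans (hB w)
        refine mul_le_mul (hB w) ((hC _).trans ?_) (norm_nonneg _) hB0
        gcongr
        have h1 := inv_one_add_norm_sub_pow_le (v - w) (v - v') (Module.finrank ℝ E + 1)
        rw [show v - w - (v - v') = v' - w by abel] at h1
        refine h1.trans ?_
        have h2 : ‖v - v'‖ < 1 := by
          rw [norm_sub_rev]
          simpa [dist_eq_norm] using hv'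
        gcongr
        linarith)
  refine ⟨contDiffOn_univ.1 h.1, fun k v => ?_⟩
  rw [h.2 k v trivial]
  simp_rw [hD]

theorem SchwartzMap.exists_norm_iteratedFDeriv_integral_le (Φ : SchwartzMap E ℂ) (k : ℕ) :
    ∃ C : ℝ, 0 ≤ C ∧ ∀ (g : E → ℂ) (B : ℝ), Measurable g → (∀ w, ‖g w‖ ≤ B) →
      ∀ v, ‖iteratedFDeriv ℝ k (fun v => ∫ w, g w * Φ (v - w)) v‖ ≤ C * B := by
  obtain ⟨C, hC0, hC⟩ := Φ.exists_norm_iteratedFDeriv_le (Module.finrank ℝ E + 1) k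
  refine ⟨C * ∫ w : E, ((1 + ‖w‖) ^ (Module.finrank ℝ E + 1))⁻¹, by positivity,
    fun g B hg hB v => ?_⟩
  rw [(Φ.contDiff_integral_sub_mul hg hB).2]
  have hB0 : 0 ≤ B := (norm_nonneg _).trans (hB 0)
  calc _ ≤ ∫ w : E, B * (C * ((1 + ‖v - w‖) ^ (Module.finrank ℝ E + 1))⁻¹) := by
        refine norm_integral_le_of_norm_le
          (((integrable_inv_one_add_norm_pow.comp_sub_left v).const_mul C).const_mul B)
          (Filter.Eventually.of_forall fun w => ?_)
        rw [norm_smul]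
        exact mul_le_mul (hB w) (hC _) (norm_nonneg _) hB0
    _ = _ := by
        rw [integral_const_mul, integral_const_mul,
          integral_sub_left_eq_self (fun w : E => ((1 + ‖w‖) ^ (Module.finrank ℝ E + 1))⁻¹)]
        ring

theorem SchwartzMap.integrable_norm_mul_one_add_norm_pow (Ψ : SchwartzMap E ℂ) (N : ℕ) :
    Integrable fun y => ‖Ψ y‖ * (1 + ‖y‖) ^ N := by
  obtain ⟨C, hC0, hC⟩ := Ψ.exists_norm_iteratedFDeriv_le (N + (Module.finrank ℝ E + 1)) 0
  have hcont := Ψ.continuous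
  refine (integrable_inv_one_add_norm_pow.const_mul C).mono'
    (by fun_prop : Continuous fun y => ‖Ψ y‖ * (1 + ‖y‖) ^ N).aestronglyMeasurable
    (Filter.Eventually.of_forall fun y => ?_)
  rw [Real.norm_of_nonneg (by positivity)]
  have h := hC y
  rw [norm_iteratedFDeriv_zero] at h
  calc _ ≤ C * ((1 + ‖y‖) ^ (N + (Module.finrank ℝ E + 1)))⁻¹ * (1 + ‖y‖) ^ N := by gcongr
    _ = _ := by
      rw [pow_add, mul_inv]
      field_simp

/-- The average over `y` of a product of smooth functions with a Schwartz function, all of them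
evaluated at linear images of `p` shifted by at most `y`. -/
theorem exists_norm_iteratedFDeriv_average_le [FiniteDimensional ℝ V] {ι : Type*} (s : Finset ι)
    (Ψ Φ : SchwartzMap E ℂ) (c : ι → ℕ → ℝ) (hc : ∀ j i, 0 ≤ c j i) (k N : ℕ) :
    ∃ C : ℝ, 0 ≤ C ∧ ∀ (b : ι → E → ℂ) (B : ι → ℝ), (∀ j ∈ s, ContDiff ℝ ∞ (b j)) →
      (∀ j ∈ s, 0 ≤ B j) →
      (∀ j ∈ s, ∀ i v, ‖iteratedFDeriv ℝ i (b j) v‖ ≤ c j i * B j) →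
      ∀ (l : ι → V →L[ℝ] E) (m : V →L[ℝ] E), (∀ j ∈ s, ‖l j‖ ≤ 2) → ‖m‖ ≤ 2 →
      ∀ (r : ι → ℝ) (q : ℝ), |q| ≤ 1 →
        ContDiff ℝ ∞ (fun p => ∫ y, Ψ y *
          ((∏ j ∈ s, b j (l j p - r j • y)) * Φ (m p - q • y))) ∧
        ∀ p : V, ‖iteratedFDeriv ℝ k (fun p => ∫ y, Ψ y *
          ((∏ j ∈ s, b j (l j p - r j • y)) * Φ (m p - q • y))) p‖
          ≤ C * (∏ j ∈ s, B j) * ((1 + ‖m p‖) ^ N)⁻¹ := by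
  choose C hC0 hC using fun k => exists_norm_iteratedFDeriv_prod_mul_le (V := V) s Φ c hc k N
  refine ⟨C k * ∫ y, ‖Ψ y‖ * (1 + ‖y‖) ^ N, mul_nonneg (hC0 k) (by positivity), ?_⟩
  intro b B hb hB hbd l m hl hm r q hq
  have hP : 0 ≤ ∏ j ∈ s, B j := Finset.prod_nonneg hB
  have hsm : ∀ y, ContDiff ℝ ∞ fun p =>
      (∏ j ∈ s, b j (l j p - r j • y)) * Φ (m p - q • y) := fun y =>
    (contDiff_prod fun j hj => (hb j hj).comp (by fun_prop)).mul ((Φ.smooth ⊤).comp (by fun_prop))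
  have hD : ∀ y k p, iteratedFDeriv ℝ k (fun p => Ψ y *
      ((∏ j ∈ s, b j (l j p - r j • y)) * Φ (m p - q • y))) p
      = Ψ y • iteratedFDeriv ℝ k (fun p =>
        (∏ j ∈ s, b j (l j p - r j • y)) * Φ (m p - q • y)) p := fun y k p =>
    iteratedFDeriv_const_smul_apply (𝕜 := ℝ) (i := k) (a := Ψ y) (x := p)
      (((hsm y).of_le (by exact_mod_cast le_top)).contDiffAt)
  have hbound : ∀ k y p, ‖iteratedFDeriv ℝ k (fun p => Ψ y *
      ((∏ j ∈ s, b j (l j p - r j • y)) * Φ (m p - q • y))) p‖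
      ≤ (C k * (∏ j ∈ s, B j) * ((1 + ‖m p‖) ^ N)⁻¹) * (‖Ψ y‖ * (1 + ‖y‖) ^ N) := by
    intro k y p
    rw [hD, norm_smul]
    have h1 := hC k b B hb hB hbd l m hl hm (fun j => r j • y) (q • y) p
    have h2 : ((1 + ‖m p - q • y‖) ^ N)⁻¹ ≤ (1 + ‖y‖) ^ N * ((1 + ‖m p‖) ^ N)⁻¹ := by
      refine (inv_one_add_norm_sub_pow_le (m p) (q • y) N).trans ?_
      have : ‖q • y‖ ≤ ‖y‖ := by
        rw [norm_smul, Real.norm_eq_abs]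
        exact mul_le_of_le_one_left (norm_nonneg y) hq
      gcongr
    calc _ ≤ ‖Ψ y‖ * (C k * (∏ j ∈ s, B j) * ((1 + ‖y‖) ^ N * ((1 + ‖m p‖) ^ N)⁻¹)) := by
          refine mul_le_mul_of_nonneg_left (h1.trans ?_) (norm_nonneg _)
          exact mul_le_mul_of_nonneg_left h2 (mul_nonneg (hC0 k) hP)
      _ = _ := by ring
  have hint := Ψ.integrable_norm_mul_one_add_norm_pow N
  have h := contDiffOn_integral_of_dominated (μ := (volume : Measure E))
    (f := fun y p => Ψ y * ((∏ j ∈ s, b j (l j p - r j • y)) * Φ (m p - q • y))) isOpen_univ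
    (Filter.Eventually.of_forall fun y => (contDiff_const.mul (hsm y)).contDiffOn)
    (fun p _ => by
      have h1 := Ψ.continuous
      have h2 := Φ.continuous
      refine Continuous.aestronglyMeasurable (h1.mul (Continuous.mul ?_ (by fun_prop)))
      exact continuous_finsetProd _ fun j hj => (hb j hj).continuous.comp (by fun_prop))
    (fun k p _ => by
      refine ⟨Set.univ, Filter.univ_mem, fun y =>
        (C k * ∏ j ∈ s, B j) * (‖Ψ y‖ * (1 + ‖y‖) ^ N), hint.const_mul _,
        Filter.Eventually.of_forall fun y p' _ => (hbound k y p').trans ?_⟩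
      refine mul_le_mul_of_nonneg_right ?_ (by positivity)
      refine mul_le_of_le_one_right (mul_nonneg (hC0 k) hP) (inv_le_one_of_one_le₀ ?_)
      exact one_le_pow₀ (by linarith [norm_nonneg (m p')]))
  refine ⟨contDiffOn_univ.1 h.1, fun p => ?_⟩
  rw [h.2 k p trivial]
  refine (norm_integral_le_of_norm_le (hint.const_mul _)
    (Filter.Eventually.of_forall fun y => hbound k y p)).trans (le_of_eq ?_)
  rw [integral_const_mul]
  ring

end SchwartzAverages

section ScaleIntegral

theorem integrableOn_inv_add_pow {s : ℝ} (hs : 0 < s) {M : ℕ} (hM : 0 < M) :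
    IntegrableOn (fun t : ℝ => ((t + s) ^ (M + 1))⁻¹) (Set.Ioi 0) ∧
      ∫ t in Set.Ioi (0 : ℝ), ((t + s) ^ (M + 1))⁻¹ ≤ (s ^ M)⁻¹ := by
  have hM' : (0 : ℝ) < M := by exact_mod_cast hM
  have hder : ∀ t ∈ Set.Ici (0 : ℝ), HasDerivAt (fun t : ℝ => -((M : ℝ)⁻¹ * ((t + s) ^ M)⁻¹))
      (((t + s) ^ (M + 1))⁻¹) t := by
    intro t ht
    have hts : t + s ≠ 0 := (add_pos_of_nonneg_of_pos ht hs).ne'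
    have h := (((((hasDerivAt_id t).add_const s).fun_pow M).fun_inv (pow_ne_zero M hts)).const_mul
      (M : ℝ)⁻¹).neg
    refine h.congr_deriv ?_
    obtain ⟨k, rfl⟩ : ∃ k, M = k + 1 := ⟨M - 1, by omega⟩
    simp only [id, Nat.add_sub_cancel]
    field_simp
    ring
  have hlim : Filter.Tendsto (fun t : ℝ => -((M : ℝ)⁻¹ * ((t + s) ^ M)⁻¹)) Filter.atTop
      (nhds 0) := by
    have h1 : Filter.Tendsto (fun t : ℝ => (t + s) ^ M) Filter.atTop Filter.atTop :=
      (Filter.tendsto_pow_atTop hM.ne').comp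
        (Filter.tendsto_atTop_add_const_right _ s Filter.tendsto_id)
    simpa using (h1.inv_tendsto_atTop.const_mul (M : ℝ)⁻¹).neg
  have hnn : ∀ t ∈ Set.Ioi (0 : ℝ), 0 ≤ ((t + s) ^ (M + 1))⁻¹ := fun t ht =>
    inv_nonneg.2 (pow_nonneg (add_pos ht hs).le _)
  have hint := integrableOn_Ioi_deriv_of_nonneg' hder hnn hlim
  refine ⟨hint, ?_⟩
  rw [integral_Ioi_of_hasDerivAt_of_tendsto' hder hint hlim]
  simp only [zero_add, zero_sub, neg_neg]
  refine mul_le_of_le_one_left (by positivity) (inv_le_one_of_one_le₀ ?_)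
  exact_mod_cast hM

variable {E V : Type*} [NormedAddCommGroup E] [NormedSpace ℝ E]
  [NormedAddCommGroup V] [NormedSpace ℝ V]

theorem norm_iteratedFDeriv_scale_le {G : V → ℂ} (hG : ContDiff ℝ ∞ G) {t : ℝ} (ht : 0 < t)
    (c : ℂ) (m : V →L[ℝ] E) (D k : ℕ) {C : ℝ}
    (hb : ∀ p, ‖iteratedFDeriv ℝ k G p‖ ≤ C * ((1 + ‖m p‖) ^ (D + k + 1))⁻¹) (u : V) :
    ‖iteratedFDeriv ℝ k (fun u => ((t ^ (D + 1))⁻¹ : ℝ) • (c * G (t⁻¹ • u))) u‖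
      ≤ ‖c‖ * C * ((t + ‖m u‖) ^ (D + k + 1))⁻¹ := by
  have hA := norm_iteratedFDeriv_comp_affine_le isOpen_univ hG.contDiffOn
    (t⁻¹ • ContinuousLinearMap.id ℝ V) 0 k (x := u) trivial
  simp only [add_zero, smul_apply, ContinuousLinearMap.id_apply] at hA
  have hnorm : ‖t⁻¹ • ContinuousLinearMap.id ℝ V‖ ≤ t⁻¹ := by
    rw [norm_smul, norm_inv, Real.norm_of_nonneg ht.le]
    exact mul_le_of_le_one_right (by positivity) ContinuousLinearMap.norm_id_le
  have hcd : ContDiff ℝ ∞ fun u => G (t⁻¹ • u) := hG.comp (by fun_prop)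
  have hcd' : ContDiffAt ℝ k (fun u => G (t⁻¹ • u)) u :=
    (hcd.of_le (by exact_mod_cast le_top)).contDiffAt
  have hD : iteratedFDeriv ℝ k (fun u => ((t ^ (D + 1))⁻¹ : ℝ) • (c * G (t⁻¹ • u))) u
      = ((t ^ (D + 1))⁻¹ : ℝ) • (c • iteratedFDeriv ℝ k (fun u => G (t⁻¹ • u)) u) := by
    have h2 := iteratedFDeriv_const_smul_apply (𝕜 := ℝ) (i := k) (a := c) hcd'
    have h1 := iteratedFDeriv_const_smul_apply (𝕜 := ℝ) (i := k) (a := ((t ^ (D + 1))⁻¹ : ℝ))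
      (f := fun u => c • G (t⁻¹ • u)) (x := u) (hcd'.const_smul c)
    exact h1.trans (congrArg _ h2)
  rw [hD, norm_smul, norm_smul, Real.norm_of_nonneg (by positivity)]
  have hmu : 1 + ‖m (t⁻¹ • u)‖ = t⁻¹ * (t + ‖m u‖) := by
    rw [map_smul, norm_smul, norm_inv, Real.norm_of_nonneg ht.le]
    field_simp
  have h3 : ‖iteratedFDeriv ℝ k (fun u => G (t⁻¹ • u)) u‖
      ≤ t⁻¹ ^ k * (C * ((t⁻¹ * (t + ‖m u‖)) ^ (D + k + 1))⁻¹) := by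
    refine hA.trans (mul_le_mul (pow_le_pow_left₀ (norm_nonneg _) hnorm k) ?_ (norm_nonneg _)
      (by positivity))
    rw [← hmu]
    exact hb _
  calc _ ≤ (t ^ (D + 1))⁻¹ *
        (‖c‖ * (t⁻¹ ^ k * (C * ((t⁻¹ * (t + ‖m u‖)) ^ (D + k + 1))⁻¹))) := by gcongr
    _ = _ := by
      have : t + ‖m u‖ ≠ 0 := (add_pos_of_pos_of_nonneg ht (norm_nonneg _)).ne'
      rw [mul_pow, show D + k + 1 = (D + 1) + k by ring, pow_add t⁻¹, inv_pow, inv_pow]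
      field_simp

/-- Integrating dilates of uniformly smooth, decaying functions over all scales gives a kernel
which is smooth off the zero set of `m` and homogeneous-type bounded there. -/
theorem contDiffOn_integral_scales [FiniteDimensional ℝ V] {G : ℝ → V → ℂ}
    (hG : ∀ t, 0 < t → ContDiff ℝ ∞ (G t)) (m : V →L[ℝ] E) {D : ℕ} (hD : 0 < D) {C : ℕ → ℝ}
    (hC : ∀ k, 0 ≤ C k)
    (hb : ∀ k t, 0 < t → ∀ p,
      ‖iteratedFDeriv ℝ k (G t) p‖ ≤ C k * ((1 + ‖m p‖) ^ (D + k + 1))⁻¹)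
    {L : ℝ → ℂ} {B : ℝ} (hL : AEStronglyMeasurable L (volume.restrict (Set.Ioi 0)))
    (hLB : ∀ t, ‖L t‖ ≤ B)
    (hmeas : ∀ u, AEStronglyMeasurable (fun t => G t (t⁻¹ • u)) (volume.restrict (Set.Ioi 0))) :
    ContDiffOn ℝ ∞ (fun u => ∫ t in Set.Ioi (0 : ℝ),
        ((t ^ (D + 1))⁻¹ : ℝ) • (L t * G t (t⁻¹ • u))) {u | m u ≠ 0} ∧
      ∀ k, ∀ u ∈ {u | m u ≠ 0}, ‖iteratedFDeriv ℝ k (fun u => ∫ t in Set.Ioi (0 : ℝ),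
        ((t ^ (D + 1))⁻¹ : ℝ) • (L t * G t (t⁻¹ • u))) u‖ ≤ C k * B * (‖m u‖ ^ (D + k))⁻¹ := by
  have hU : IsOpen {u | m u ≠ 0} := isOpen_ne_fun m.continuous continuous_const
  have hB : 0 ≤ B := (norm_nonneg _).trans (hLB 0)
  have hbound : ∀ k t, 0 < t → ∀ u, ‖iteratedFDeriv ℝ k (fun u =>
      ((t ^ (D + 1))⁻¹ : ℝ) • (L t * G t (t⁻¹ • u))) u‖
      ≤ C k * B * ((t + ‖m u‖) ^ (D + k + 1))⁻¹ := by
    intro k t ht u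
    refine (norm_iteratedFDeriv_scale_le (hG t ht) ht (L t) m D k (hb k t ht) u).trans ?_
    rw [mul_comm (C k)]
    have := hC k
    gcongr
    exact hLB t
  have h := contDiffOn_integral_of_dominated (μ := volume.restrict (Set.Ioi (0 : ℝ)))
    (f := fun t u => ((t ^ (D + 1))⁻¹ : ℝ) • (L t * G t (t⁻¹ • u))) hU
    ((ae_restrict_mem measurableSet_Ioi).mono fun t ht =>
      ((contDiff_const.mul ((hG t ht).comp
        (by fun_prop : ContDiff ℝ ∞ fun u : V => t⁻¹ • u))).const_smul
        ((t ^ (D + 1))⁻¹ : ℝ)).contDiffOn)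
    (fun u _ => by
      refine AEStronglyMeasurable.smul (f := fun t : ℝ => (t ^ (D + 1))⁻¹) ?_ (hL.mul (hmeas u))
      exact (by fun_prop : Measurable fun t : ℝ => ((t ^ (D + 1))⁻¹ : ℝ)).aestronglyMeasurable)
    (fun k u (hu : m u ≠ 0) => by
      have hpos : 0 < ‖m u‖ := norm_pos_iff.2 hu
      refine ⟨{u' | ‖m u‖ / 2 < ‖m u'‖}, ?_, fun t => C k * B *
        ((t + ‖m u‖ / 2) ^ (D + k + 1))⁻¹, ?_, ?_⟩
      · exact (isOpen_lt continuous_const (by fun_prop)).mem_nhds (half_lt_self hpos)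
      · exact ((integrableOn_inv_add_pow (half_pos hpos) (by omega : 0 < D + k)).1).const_mul _
      · refine (ae_restrict_mem measurableSet_Ioi).mono fun t ht u' hu' =>
          (hbound k t ht u').trans ?_
        have h1 : 0 < t := ht
        have h2 : ‖m u‖ / 2 < ‖m u'‖ := hu'
        have := hC k
        beta_reduce
        gcongr)
  refine ⟨h.1, fun k u hu => ?_⟩
  have hpos : 0 < ‖m u‖ := norm_pos_iff.2 hu
  have hI := integrableOn_inv_add_pow hpos (by omega : 0 < D + k)
  rw [h.2 k u hu]
  refine (norm_integral_le_of_norm_le (hI.1.const_mul (C k * B))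
    ((ae_restrict_mem measurableSet_Ioi).mono fun t ht => hbound k t ht u)).trans ?_
  rw [integral_const_mul]
  exact mul_le_mul_of_nonneg_left hI.2 (mul_nonneg (hC k) hB)

end ScaleIntegral

section Kernel

variable {d n : ℕ}

theorem integral_eq_smul_integral_comp_smul {F : Type*} [NormedAddCommGroup F] [NormedSpace ℝ F]
    {t : ℝ} (ht : t ≠ 0) (g : EuclideanSpace ℝ (Fin d) → F) :
    ∫ w, g w = (|t| ^ d : ℝ) • ∫ w, g (t • w) := by
  rw [Measure.integral_comp_smul, finrank_euclideanSpace_fin, smul_smul, abs_inv, abs_pow,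
    mul_inv_cancel₀ (by positivity), one_smul]

theorem convDil_eq_integral (Φ f : EuclideanSpace ℝ (Fin d) → ℂ) {t : ℝ}
    (ht : t ≠ 0) (x : EuclideanSpace ℝ (Fin d)) :
    convDil Φ t f x = ∫ w, f (t • w) * Φ (t⁻¹ • x - w) := by
  have h1 := integral_sub_left_eq_self (fun w => dil Φ t w * f (x - w)) volume x
  simp only [sub_sub_cancel] at h1
  rw [convDil, ← h1, integral_eq_smul_integral_comp_smul ht, ← integral_smul]
  congr 1 with w
  have h2 : t⁻¹ • (x - t • w) = t⁻¹ • x - w := by rw [smul_sub, inv_smul_smul₀ ht]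
  rw [dil, h2, smul_mul_assoc, smul_smul, mul_inv_cancel₀ (by positivity), one_smul, mul_comm]

/-- The integrand in `modelKernel` at a single scale. -/
noncomputable def scaleKernel (Ψ : EuclideanSpace ℝ (Fin d) → ℂ)
    (Φ : Fin (n + 1) → EuclideanSpace ℝ (Fin d) → ℂ) (lam ρ : Fin (n + 1) → ℝ)
    (f : Fin (n + 1) → EuclideanSpace ℝ (Fin d) → ℂ) (t : ℝ)
    (x z : EuclideanSpace ℝ (Fin d)) : ℂ :=
  ∫ y, dil Ψ t y *
    (∏ j ∈ Finset.univ.erase (Fin.last n),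
      convDil (Φ j) (lam j * t) (f j) (x - (ρ j * lam j) • y)) *
    dil (Φ (Fin.last n)) (lam (Fin.last n) * t)
      (x - (ρ (Fin.last n) * lam (Fin.last n)) • y - z)

theorem modelKernel_eq_integral_scaleKernel (Ψ : EuclideanSpace ℝ (Fin d) → ℂ)
    (Φ : Fin (n + 1) → EuclideanSpace ℝ (Fin d) → ℂ) (L : ℝ → ℂ) (lam ρ : Fin (n + 1) → ℝ)
    (f : Fin (n + 1) → EuclideanSpace ℝ (Fin d) → ℂ) (x z : EuclideanSpace ℝ (Fin d)) :
    modelKernel d n Ψ Φ L lam ρ f x z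
      = ∫ t in Set.Ioi (0 : ℝ), scaleKernel Ψ Φ lam ρ f t x z * L t / (t : ℂ) :=
  rfl

theorem scaleKernel_eq_smul_integral (Ψ : EuclideanSpace ℝ (Fin d) → ℂ)
    (Φ : Fin (n + 1) → EuclideanSpace ℝ (Fin d) → ℂ) {lam : Fin (n + 1) → ℝ}
    (hlam : ∀ i, lam i ≠ 0) (ρ : Fin (n + 1) → ℝ)
    (f : Fin (n + 1) → EuclideanSpace ℝ (Fin d) → ℂ) {t : ℝ} (ht : 0 < t)
    (x z : EuclideanSpace ℝ (Fin d)) :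
    scaleKernel Ψ Φ lam ρ f t x z = ((|lam (Fin.last n) * t| ^ d)⁻¹ : ℝ) •
      ∫ y, Ψ y * ((∏ j ∈ Finset.univ.erase (Fin.last n),
        ∫ w, f j ((lam j * t) • w) * Φ j ((lam j * t)⁻¹ • x - ρ j • y - w)) *
        Φ (Fin.last n) ((lam (Fin.last n) * t)⁻¹ • (x - z) - ρ (Fin.last n) • y)) := by
  have hlt : ∀ j, lam j * t ≠ 0 := fun j => mul_ne_zero (hlam j) ht.ne'
  have hs : ∀ j (y : EuclideanSpace ℝ (Fin d)),
      (lam j * t)⁻¹ • ((ρ j * lam j) • t • y) = ρ j • y := by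
    intro j y
    rw [smul_smul, smul_smul]
    congr 1
    have h1 := hlam j
    field_simp
  rw [scaleKernel, integral_eq_smul_integral_comp_smul ht.ne', ← integral_smul, ← integral_smul]
  congr 1 with y
  rw [dil, dil, inv_smul_smul₀ ht.ne', sub_right_comm, smul_sub, hs]
  simp_rw [convDil_eq_integral _ _ (hlt _), smul_sub _ x, hs]
  rw [mul_smul_comm, smul_mul_assoc, smul_mul_assoc, smul_smul, smul_smul, mul_comm (|t| ^ d),
    mul_inv_cancel_right₀ (by positivity), mul_assoc]

end Kernel

section Profile

variable {d n : ℕ}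

/-- `scaleKernel` in coordinates normalised by the scale. -/
noncomputable def scaleProfile (Ψ : EuclideanSpace ℝ (Fin d) → ℂ)
    (Φ : Fin (n + 1) → EuclideanSpace ℝ (Fin d) → ℂ) (lam ρ : Fin (n + 1) → ℝ)
    (f : Fin (n + 1) → EuclideanSpace ℝ (Fin d) → ℂ) {V : Type*} [NormedAddCommGroup V]
    [NormedSpace ℝ V] (l : Fin (n + 1) → V →L[ℝ] EuclideanSpace ℝ (Fin d))
    (m : V →L[ℝ] EuclideanSpace ℝ (Fin d)) (t : ℝ) (p : V) : ℂ :=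
  ∫ y, Ψ y * ((∏ j ∈ Finset.univ.erase (Fin.last n),
    ∫ w, f j ((lam j * t) • w) * Φ j (l j p - ρ j • y - w)) *
    Φ (Fin.last n) (m p - ρ (Fin.last n) • y))

variable {V : Type*} [NormedAddCommGroup V] [NormedSpace ℝ V]

theorem stronglyMeasurable_scaleProfile [MeasurableSpace V] [BorelSpace V]
    {Ψ : EuclideanSpace ℝ (Fin d) → ℂ}
    {Φ : Fin (n + 1) → EuclideanSpace ℝ (Fin d) → ℂ} (hΨ : Measurable Ψ)
    (hΦ : ∀ j, Measurable (Φ j))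
    (lam ρ : Fin (n + 1) → ℝ) {f : Fin (n + 1) → EuclideanSpace ℝ (Fin d) → ℂ}
    (hf : ∀ j ∈ Finset.univ.erase (Fin.last n), Measurable (f j))
    (l : Fin (n + 1) → V →L[ℝ] EuclideanSpace ℝ (Fin d))
    (m : V →L[ℝ] EuclideanSpace ℝ (Fin d)) :
    StronglyMeasurable fun q : ℝ × V => scaleProfile Ψ Φ lam ρ f l m q.1 q.2 := by
  refine StronglyMeasurable.integral_prod_right' (f := fun q : (ℝ × V) × EuclideanSpace ℝ (Fin d) =>
    Ψ q.2 * ((∏ j ∈ Finset.univ.erase (Fin.last n),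
      ∫ w, f j ((lam j * q.1.1) • w) * Φ j (l j q.1.2 - ρ j • q.2 - w)) *
      Φ (Fin.last n) (m q.1.2 - ρ (Fin.last n) • q.2))) ?_
  refine Measurable.stronglyMeasurable ?_
  have hl : ∀ j, Measurable (l j) := fun j => (l j).continuous.measurable
  have hm : Measurable m := m.continuous.measurable
  have hp : ∀ j ∈ Finset.univ.erase (Fin.last n),
      Measurable fun q : (ℝ × V) × EuclideanSpace ℝ (Fin d) =>
        ∫ w, f j ((lam j * q.1.1) • w) * Φ j (l j q.1.2 - ρ j • q.2 - w) := by
    intro j hj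
    have h1 := hf j hj
    have h2 := hΦ j
    have h3 := hl j
    refine StronglyMeasurable.measurable (StronglyMeasurable.integral_prod_right'
      (f := fun r : ((ℝ × V) × EuclideanSpace ℝ (Fin d)) × EuclideanSpace ℝ (Fin d) =>
        f j ((lam j * r.1.1.1) • r.2) * Φ j (l j r.1.1.2 - ρ j • r.1.2 - r.2))
      (Measurable.stronglyMeasurable ?_))
    fun_prop
  have h1 := hΦ (Fin.last n)
  have h2 := Finset.measurable_fun_prod _ hp
  fun_prop

theorem exists_norm_iteratedFDeriv_scaleProfile_le [FiniteDimensional ℝ V]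
    (Ψ : SchwartzMap (EuclideanSpace ℝ (Fin d)) ℂ)
    (Φ : Fin (n + 1) → SchwartzMap (EuclideanSpace ℝ (Fin d)) ℂ) (k N : ℕ) :
    ∃ C : ℝ, 0 ≤ C ∧ ∀ (lam ρ : Fin (n + 1) → ℝ), |ρ (Fin.last n)| ≤ 1 →
      ∀ (f : Fin (n + 1) → EuclideanSpace ℝ (Fin d) → ℂ) (Fb : Fin (n + 1) → ℝ),
      (∀ j ∈ Finset.univ.erase (Fin.last n), Measurable (f j)) → (∀ j x, ‖f j x‖ ≤ Fb j) →
      ∀ (l : Fin (n + 1) → V →L[ℝ] EuclideanSpace ℝ (Fin d))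
        (m : V →L[ℝ] EuclideanSpace ℝ (Fin d)), (∀ j, ‖l j‖ ≤ 2) → ‖m‖ ≤ 2 → ∀ t,
      ContDiff ℝ ∞ (scaleProfile Ψ (fun j => Φ j) lam ρ f l m t) ∧
      ∀ p, ‖iteratedFDeriv ℝ k (scaleProfile Ψ (fun j => Φ j) lam ρ f l m t) p‖
        ≤ C * (∏ j ∈ Finset.univ.erase (Fin.last n), Fb j) * ((1 + ‖m p‖) ^ N)⁻¹ := by
  choose c hc0 hc using fun j k => (Φ j).exists_norm_iteratedFDeriv_integral_le k
  obtain ⟨C, hC0, hC⟩ := exists_norm_iteratedFDeriv_average_le (V := V)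
    (Finset.univ.erase (Fin.last n)) Ψ (Φ (Fin.last n)) c hc0 k N
  refine ⟨C, hC0, fun lam ρ hρ f Fb hf hFb l m hl hm t => ?_⟩
  have hg : ∀ j ∈ Finset.univ.erase (Fin.last n), Measurable fun w => f j ((lam j * t) • w) :=
    fun j hj => (hf j hj).comp (by fun_prop)
  exact hC (fun j v => ∫ w, f j ((lam j * t) • w) * Φ j (v - w)) Fb
    (fun j hj => ((Φ j).contDiff_integral_sub_mul (hg j hj) fun w => hFb j _).1)
    (fun j _ => (norm_nonneg _).trans (hFb j 0))
    (fun j hj i v => hc j i _ _ (hg j hj) (fun w => hFb j _) v) l m (fun j _ => hl j) hm ρ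
    (ρ (Fin.last n)) hρ

end Profile

section NormalisedCoordinates

variable {d n : ℕ}

open ContinuousLinearMap in
theorem scaleKernel_eq_smul_scaleProfile (Ψ : EuclideanSpace ℝ (Fin d) → ℂ)
    (Φ : Fin (n + 1) → EuclideanSpace ℝ (Fin d) → ℂ) {lam : Fin (n + 1) → ℝ}
    (hlam : ∀ i, lam i ≠ 0) (ρ : Fin (n + 1) → ℝ)
    (f : Fin (n + 1) → EuclideanSpace ℝ (Fin d) → ℂ) {a μ : ℝ} (ha : a ≠ 0) (hμ : μ ≠ 0) {t : ℝ}
    (ht : 0 < t) (x z : EuclideanSpace ℝ (Fin d)) :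
    scaleKernel Ψ Φ lam ρ f t x z = ((|lam (Fin.last n)| ^ d)⁻¹ : ℝ) • ((t ^ d)⁻¹ : ℝ) •
      scaleProfile Ψ Φ lam ρ f (fun j => (μ / lam j) • fst ℝ _ _)
        ((μ / lam (Fin.last n)) • fst ℝ _ _ - (a / lam (Fin.last n)) • snd ℝ _ _) t
        (t⁻¹ • ((μ⁻¹ • inl ℝ _ _) x + (a⁻¹ • inr ℝ _ _) z)) := by
  rw [scaleKernel_eq_smul_integral Ψ Φ hlam ρ f ht, scaleProfile, smul_smul, ← mul_inv, ← mul_pow,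
    abs_mul, abs_of_pos ht]
  have h1 : ∀ j, (μ / lam j) • t⁻¹ • μ⁻¹ • x = (lam j * t)⁻¹ • x := by
    intro j
    have := hlam j
    rw [smul_smul, smul_smul]
    congr 1
    field_simp
  have h2 : (a / lam (Fin.last n)) • t⁻¹ • a⁻¹ • z = (lam (Fin.last n) * t)⁻¹ • z := by
    have := hlam (Fin.last n)
    rw [smul_smul, smul_smul]
    congr 1
    field_simp
  simp [h1, h2, smul_sub]

open ContinuousLinearMap in
theorem norm_div_smul_fst_le_one {E F : Type*} [NormedAddCommGroup E] [NormedSpace ℝ E]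
    [NormedAddCommGroup F] [NormedSpace ℝ F] {μ b : ℝ} (hμ : 0 < μ) (hb : μ ≤ |b|) :
    ‖(μ / b) • fst ℝ E F‖ ≤ 1 := by
  rw [norm_smul, Real.norm_eq_abs, abs_div, abs_of_pos hμ]
  exact mul_le_one₀ (div_le_one_of_le₀ hb (abs_nonneg _)) (norm_nonneg _) (norm_fst_le ..)

open ContinuousLinearMap in
theorem norm_smul_fst_sub_smul_snd_le_two {E : Type*} [NormedAddCommGroup E] [NormedSpace ℝ E]
    {μ b : ℝ} (hμ : 0 < μ) (hb : μ ≤ |b|) :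
    ‖(μ / b) • fst ℝ E E - (|b| / b) • snd ℝ E E‖ ≤ 2 := by
  refine (norm_sub_le _ _).trans ?_
  have h2 : ‖(|b| / b) • snd ℝ E E‖ ≤ 1 := by
    rw [norm_smul, Real.norm_eq_abs, abs_div, abs_abs]
    exact mul_le_one₀ (div_self_le_one _) (norm_nonneg _) (norm_snd_le ..)
  linarith [norm_div_smul_fst_le_one (E := E) (F := E) hμ hb]

open ContinuousLinearMap in
/-- The kernel estimate for measurable data. It is stated for functions `h` which take at each
point either the value of the kernel or `0`. -/
theorem exists_norm_iteratedFDeriv_kernel_le (hd : 0 < d)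
    (Ψ : SchwartzMap (EuclideanSpace ℝ (Fin d)) ℂ)
    (Φ : Fin (n + 1) → SchwartzMap (EuclideanSpace ℝ (Fin d)) ℂ) (α β : ℕ) :
    ∃ C : ℝ, 0 ≤ C ∧ ∀ (lam ρ : Fin (n + 1) → ℝ), (∀ i, lam i ≠ 0) → |ρ (Fin.last n)| ≤ 1 →
      ∀ μ, 0 < μ → (∀ i, μ ≤ |lam i|) →
      ∀ (L : ℝ → ℂ) (CL : ℝ), AEStronglyMeasurable L (volume.restrict (Set.Ioi 0)) →
      (∀ t, ‖L t‖ ≤ CL) →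
      ∀ (f : Fin (n + 1) → EuclideanSpace ℝ (Fin d) → ℂ) (Fb : Fin (n + 1) → ℝ),
      (∀ j ∈ Finset.univ.erase (Fin.last n), Measurable (f j)) → (∀ j x, ‖f j x‖ ≤ Fb j) →
      ∀ h : EuclideanSpace ℝ (Fin d) → EuclideanSpace ℝ (Fin d) → ℂ,
      (∀ x z, h x z = 0 ∨ h x z = modelKernel d n Ψ (fun j => Φ j) L lam ρ f x z) →
      ∀ x z, x ≠ z → ‖iteratedFDeriv ℝ β (fun z' => iteratedFDeriv ℝ α (fun x' => h x' z') x) z‖ ≤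
        C * (|lam (Fin.last n)| / μ) ^ α * (‖x - z‖ ^ (d + α + β))⁻¹ * CL *
          ∏ j ∈ Finset.univ.erase (Fin.last n), Fb j := by
  choose C hC0 hC using fun k => exists_norm_iteratedFDeriv_scaleProfile_le
    (V := EuclideanSpace ℝ (Fin d) × EuclideanSpace ℝ (Fin d)) Ψ Φ k (d + k + 1)
  refine ⟨C (α + β), hC0 _, ?_⟩
  intro lam ρ hlam hρ μ hμ hmin L CL hL hLB f Fb hf hFb h hh x z hxz
  set a := |lam (Fin.last n)| with ha_def
  have ha : 0 < a := abs_pos.2 (hlam _)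
  have hP : 0 ≤ ∏ j ∈ Finset.univ.erase (Fin.last n), Fb j :=
    Finset.prod_nonneg fun j _ => (norm_nonneg _).trans (hFb j 0)
  set l : Fin (n + 1) → EuclideanSpace ℝ (Fin d) × EuclideanSpace ℝ (Fin d) →L[ℝ]
    EuclideanSpace ℝ (Fin d) := fun j => (μ / lam j) • fst ℝ _ _ with hl_def
  set m : EuclideanSpace ℝ (Fin d) × EuclideanSpace ℝ (Fin d) →L[ℝ] EuclideanSpace ℝ (Fin d) :=
    (μ / lam (Fin.last n)) • fst ℝ _ _ - (a / lam (Fin.last n)) • snd ℝ _ _ with hm_def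
  set A : EuclideanSpace ℝ (Fin d) →L[ℝ] EuclideanSpace ℝ (Fin d) × EuclideanSpace ℝ (Fin d) :=
    μ⁻¹ • inl ℝ _ _ with hA_def
  set B : EuclideanSpace ℝ (Fin d) →L[ℝ] EuclideanSpace ℝ (Fin d) × EuclideanSpace ℝ (Fin d) :=
    a⁻¹ • inr ℝ _ _ with hB_def
  have hl : ∀ j, ‖l j‖ ≤ 2 := fun j =>
    (norm_div_smul_fst_le_one hμ (hmin j)).trans one_le_two
  have hm : ‖m‖ ≤ 2 := norm_smul_fst_sub_smul_snd_le_two hμ (hmin _)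
  have hA : ‖A‖ ≤ μ⁻¹ := by
    rw [hA_def, norm_smul, norm_inv, Real.norm_of_nonneg hμ.le]
    exact mul_le_of_le_one_right (by positivity) (norm_inl_le_one ..)
  have hB : ‖B‖ ≤ a⁻¹ := by
    rw [hB_def, norm_smul, norm_inv, Real.norm_of_nonneg ha.le]
    exact mul_le_of_le_one_right (by positivity) (norm_inr_le_one ..)
  have hmAB : ∀ x z, m (A x + B z) = (lam (Fin.last n))⁻¹ • (x - z) := fun x z => by
    have h1 : (μ / lam (Fin.last n)) • μ⁻¹ • x = (lam (Fin.last n))⁻¹ • x := by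
      rw [smul_smul]
      congr 1
      field_simp
    have h2 : (a / lam (Fin.last n)) • a⁻¹ • z = (lam (Fin.last n))⁻¹ • z := by
      rw [smul_smul]
      congr 1
      field_simp
    simp [hm_def, hA_def, hB_def, h1, h2, smul_sub]
  have hprof := fun k => hC k lam ρ hρ f Fb hf hFb l m hl hm
  obtain ⟨hJ, hJk⟩ := contDiffOn_integral_scales
    (G := scaleProfile Ψ (fun j => Φ j) lam ρ f l m) (fun t _ => (hprof 0 t).1) m hd
    (C := fun k => C k * ∏ j ∈ Finset.univ.erase (Fin.last n), Fb j)
    (fun k => mul_nonneg (hC0 k) hP) (fun k t _ => (hprof k t).2) hL hLB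
    (fun u => ((stronglyMeasurable_scaleProfile Ψ.continuous.measurable
      (fun j => (Φ j).continuous.measurable) lam ρ hf l m).comp_measurable
      (by fun_prop : Measurable fun t : ℝ => (t, t⁻¹ • u))).aestronglyMeasurable)
  set J := fun u => ∫ t in Set.Ioi (0 : ℝ), ((t ^ (d + 1))⁻¹ : ℝ) •
    (L t * scaleProfile Ψ (fun j => Φ j) lam ρ f l m t (t⁻¹ • u)) with hJ_def
  have hK : ∀ x z, modelKernel d n Ψ (fun j => Φ j) L lam ρ f x z
      = ((a ^ d)⁻¹ : ℝ) • J (A x + B z) := by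
    intro x z
    rw [modelKernel_eq_integral_scaleKernel, hJ_def, ← integral_smul]
    refine setIntegral_congr_fun measurableSet_Ioi fun t ht => ?_
    have ht' : 0 < t := ht
    beta_reduce
    rw [scaleKernel_eq_smul_scaleProfile Ψ (fun j => Φ j) hlam ρ f ha.ne' hμ.ne' ht']
    simp only [Complex.real_smul, ← ha_def, ← hm_def, ← hA_def, ← hB_def, ← hl_def]
    push_cast
    rw [pow_succ (t : ℂ), mul_inv]
    ring
  have hU : IsOpen {u | m u ≠ 0} := isOpen_ne_fun m.continuous continuous_const
  have hmem : A x + B z ∈ {u | m u ≠ 0} := by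
    change m (A x + B z) ≠ 0
    rw [hmAB]
    exact smul_ne_zero (inv_ne_zero (hlam _)) (sub_ne_zero.2 hxz)
  have hbase := norm_iteratedFDeriv_slices_le_of_eq_zero_or_eq hU
    (hJ.const_smul ((a ^ d)⁻¹ : ℝ)) A B (h := h)
    (fun x z _ => by simpa only [hK] using hh x z) α β hmem
  have hD : iteratedFDeriv ℝ (α + β) (((a ^ d)⁻¹ : ℝ) • J) (A x + B z)
      = ((a ^ d)⁻¹ : ℝ) • iteratedFDeriv ℝ (α + β) J (A x + B z) :=
    iteratedFDeriv_const_smul_apply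
      ((hJ.contDiffAt (hU.mem_nhds hmem)).of_le (by exact_mod_cast le_top))
  clear_value A B J
  have hDJ := hJk (α + β) _ hmem
  rw [hmAB, norm_smul, norm_inv, Real.norm_eq_abs, ← ha_def] at hDJ
  have hxz' : 0 < ‖x - z‖ := norm_pos_iff.2 (sub_ne_zero.2 hxz)
  refine hbase.trans ?_
  change _ * ‖iteratedFDeriv ℝ (α + β) (((a ^ d)⁻¹ : ℝ) • J) (A x + B z)‖ ≤ _
  rw [hD, norm_smul, Real.norm_of_nonneg (by positivity)]
  calc _ ≤ μ⁻¹ ^ α * a⁻¹ ^ β * ((a ^ d)⁻¹ *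
        (C (α + β) * (∏ j ∈ Finset.univ.erase (Fin.last n), Fb j) * CL *
          ((a⁻¹ * ‖x - z‖) ^ (d + (α + β)))⁻¹)) := by gcongr
    _ = _ := by
      rw [mul_pow, ← add_assoc, pow_add a⁻¹, pow_add a⁻¹]
      simp only [inv_pow, div_pow]
      field_simp

end NormalisedCoordinates

section MeasurableModification

/-- A possibly non-measurable weight `L` can be replaced by a measurable one `L'`, in the sense
that for each `x` the integral against `L` either vanishes or agrees with that against `L'`. -/
theorem exists_aestronglyMeasurable_integral_eq_zero_or_eq {T X : Type*} [MeasurableSpace T]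
    {μ : Measure T} [TopologicalSpace X] [SecondCountableTopology X] {k : T → X → ℂ}
    (hk : ∀ x, AEStronglyMeasurable (fun t => k t x) μ) (hkc : ∀ᵐ t ∂μ, Continuous (k t))
    (L : T → ℂ) :
    ∃ L' : T → ℂ, AEStronglyMeasurable L' μ ∧ (∀ t, ‖L' t‖ ≤ ‖L t‖) ∧
      ∀ x, ∫ t, k t x * L t ∂μ = 0 ∨ ∫ t, k t x * L t ∂μ = ∫ t, k t x * L' t ∂μ := by
  set S := {x | AEStronglyMeasurable (fun t => k t x * L t) μ} with hS
  obtain ⟨D, hDc, hDd⟩ := TopologicalSpace.exists_countable_dense S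
  have hnull : ∀ x, NullMeasurableSet {t | k t x ≠ 0} μ := fun x =>
    (hk x).aemeasurable.nullMeasurable (measurableSet_singleton 0).compl
  set M := ⋃ x ∈ D, {t | k t x ≠ 0} with hM
  have hMnull : NullMeasurableSet M μ := .biUnion hDc fun x _ => hnull x
  refine ⟨M.indicator L, ?_, fun t => norm_indicator_le_norm_self L t, fun x => ?_⟩
  · rw [aestronglyMeasurable_indicator_iff₀ hMnull, hM, Set.biUnion_eq_iUnion]
    have := hDc.to_subtype
    refine (aestronglyMeasurable_iUnion_iff).2 fun x => ?_
    refine ((x.1.2.aemeasurable.div (hk x.1.1).aemeasurable).aestronglyMeasurable.mono_measure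
      Measure.restrict_le_self).congr ?_
    rw [Filter.EventuallyEq, ae_restrict_iff'₀ (hnull _)]
    exact .of_forall fun t ht => mul_div_cancel_left₀ _ ht
  · by_cases hx : x ∈ S
    · refine .inr (integral_congr_ae ?_)
      filter_upwards [hkc] with t ht
      by_cases htM : t ∈ M
      · rw [Set.indicator_of_mem htM]
      · have hD0 : Set.EqOn (fun y : S => k t y) 0 D := fun y hy => by
          by_contra h
          exact htM (Set.mem_biUnion hy h)
        have h0 := Continuous.ext_on hDd (ht.comp continuous_subtype_val) continuous_const hD0
        have h1 : k t x = 0 := congr_fun h0 ⟨x, hx⟩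
        rw [h1, zero_mul, zero_mul]
    · exact .inl (integral_non_aestronglyMeasurable hx)

variable {d n : ℕ}

theorem convDil_eq_zero_of_not_aestronglyMeasurable {Φ f : EuclideanSpace ℝ (Fin d) → ℂ}
    (hΦm : Measurable Φ) (hΦ : ∀ᵐ v, Φ v ≠ 0) (hf : ¬ AEStronglyMeasurable f volume) {t : ℝ}
    (ht : t ≠ 0) (x : EuclideanSpace ℝ (Fin d)) : convDil Φ t f x = 0 := by
  refine integral_non_aestronglyMeasurable fun h => hf ?_
  have hdm : Measurable (dil Φ t) := by
    unfold dil
    fun_prop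
  have hd0 : ∀ᵐ w, dil Φ t w ≠ 0 := by
    rw [ae_iff] at hΦ ⊢
    refine measure_mono_null (t := (t⁻¹ • ·) ⁻¹' {v | ¬ Φ v ≠ 0}) (fun w hw => ?_) ?_
    · simpa [dil, ht] using hw
    · rw [Measure.addHaar_preimage_smul _ (inv_ne_zero ht), hΦ, mul_zero]
  have h1 : AEStronglyMeasurable (fun w => f (x - w)) volume := by
    refine (h.aemeasurable.div hdm.aemeasurable).aestronglyMeasurable.congr ?_
    filter_upwards [hd0] with w hw using mul_div_cancel_left₀ _ hw
  simpa [Function.comp_def] using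
    h1.comp_quasiMeasurePreserving (quasiMeasurePreserving_sub_left volume x)

theorem convDil_congr_ae (Φ : EuclideanSpace ℝ (Fin d) → ℂ) (t : ℝ)
    {f g : EuclideanSpace ℝ (Fin d) → ℂ} (hfg : f =ᵐ[volume] g)
    (x : EuclideanSpace ℝ (Fin d)) : convDil Φ t f x = convDil Φ t g x := by
  refine integral_congr_ae ?_
  filter_upwards [(quasiMeasurePreserving_sub_left volume x).ae hfg] with w hw
  rw [hw]

theorem exists_measurable_ae_eq_norm_le {T : Type*} [MeasurableSpace T] {μ : Measure T}
    {f : T → ℂ} (hf : AEStronglyMeasurable f μ) {B : ℝ} (hfB : ∀ x, ‖f x‖ ≤ B) (hB : 0 ≤ B) :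
    ∃ g : T → ℂ, Measurable g ∧ (∀ x, ‖g x‖ ≤ B) ∧ f =ᵐ[μ] g := by
  have hm := hf.stronglyMeasurable_mk.measurable
  refine ⟨{x | ‖hf.mk f x‖ ≤ B}.indicator (hf.mk f),
    hm.indicator (measurableSet_le hm.norm measurable_const), fun x => ?_, ?_⟩
  · by_cases hx : ‖hf.mk f x‖ ≤ B <;> simp [Set.indicator, hx, hB]
  · filter_upwards [hf.ae_eq_mk] with x hx
    rw [Set.indicator_of_mem, hx]
    simpa [← hx] using hfB x

theorem modelKernel_congr_convDil (Ψ : EuclideanSpace ℝ (Fin d) → ℂ)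
    (Φ : Fin (n + 1) → EuclideanSpace ℝ (Fin d) → ℂ) (L : ℝ → ℂ) (lam ρ : Fin (n + 1) → ℝ)
    {f g : Fin (n + 1) → EuclideanSpace ℝ (Fin d) → ℂ}
    (h : ∀ j ∈ Finset.univ.erase (Fin.last n), ∀ t > 0, ∀ x,
      convDil (Φ j) (lam j * t) (f j) x = convDil (Φ j) (lam j * t) (g j) x) :
    modelKernel d n Ψ Φ L lam ρ f = modelKernel d n Ψ Φ L lam ρ g := by
  ext x z
  refine setIntegral_congr_fun measurableSet_Ioi fun t ht => ?_
  congr 3 with y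
  congr 2
  exact Finset.prod_congr rfl fun j hj => h j hj t ht _

theorem modelKernel_eq_zero_of_convDil_eq_zero (Ψ : EuclideanSpace ℝ (Fin d) → ℂ)
    (Φ : Fin (n + 1) → EuclideanSpace ℝ (Fin d) → ℂ) (L : ℝ → ℂ) (lam ρ : Fin (n + 1) → ℝ)
    {f : Fin (n + 1) → EuclideanSpace ℝ (Fin d) → ℂ} {j : Fin (n + 1)}
    (hj : j ∈ Finset.univ.erase (Fin.last n))
    (h : ∀ t > 0, ∀ x, convDil (Φ j) (lam j * t) (f j) x = 0)
    (x z : EuclideanSpace ℝ (Fin d)) : modelKernel d n Ψ Φ L lam ρ f x z = 0 := by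
  refine setIntegral_eq_zero_of_forall_eq_zero fun t ht => ?_
  have h0 : ∀ y, ∏ j ∈ Finset.univ.erase (Fin.last n),
      convDil (Φ j) (lam j * t) (f j) (x - (ρ j * lam j) • y) = 0 := fun y =>
    Finset.prod_eq_zero hj (h t ht _)
  simp [h0]

end MeasurableModification

section Kernel

variable {d n : ℕ}

theorem continuous_scaleKernel_and_measurable (Ψ : SchwartzMap (EuclideanSpace ℝ (Fin d)) ℂ)
    (Φ : Fin (n + 1) → SchwartzMap (EuclideanSpace ℝ (Fin d)) ℂ) {lam ρ : Fin (n + 1) → ℝ}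
    (hlam : ∀ i, lam i ≠ 0) (hρ : |ρ (Fin.last n)| ≤ 1) {μ : ℝ} (hμ : 0 < μ)
    (hmin : ∀ i, μ ≤ |lam i|) {f : Fin (n + 1) → EuclideanSpace ℝ (Fin d) → ℂ}
    {Fb : Fin (n + 1) → ℝ} (hf : ∀ j ∈ Finset.univ.erase (Fin.last n), Measurable (f j))
    (hFb : ∀ j x, ‖f j x‖ ≤ Fb j) :
    (∀ t > 0, Continuous fun p : EuclideanSpace ℝ (Fin d) × EuclideanSpace ℝ (Fin d) =>
      scaleKernel Ψ (fun j => Φ j) lam ρ f t p.1 p.2) ∧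
    ∀ x z, AEStronglyMeasurable (fun t => scaleKernel Ψ (fun j => Φ j) lam ρ f t x z)
      (volume.restrict (Set.Ioi 0)) := by
  have ha : 0 < |lam (Fin.last n)| := abs_pos.2 (hlam _)
  obtain ⟨C, -, hC⟩ := exists_norm_iteratedFDeriv_scaleProfile_le
    (V := EuclideanSpace ℝ (Fin d) × EuclideanSpace ℝ (Fin d)) Ψ Φ 0 0
  refine ⟨fun t ht => ?_, fun x z => ?_⟩
  · have := (hC lam ρ hρ f Fb hf hFb _ _
      (fun j => (norm_div_smul_fst_le_one hμ (hmin j)).trans one_le_two)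
      (norm_smul_fst_sub_smul_snd_le_two hμ (hmin (Fin.last n))) t).1.continuous
    simp only [scaleKernel_eq_smul_scaleProfile Ψ (fun j => Φ j) hlam ρ f ha.ne' hμ.ne' ht]
    fun_prop
  · have h := stronglyMeasurable_scaleProfile Ψ.continuous.measurable
      (fun j => (Φ j).continuous.measurable) lam ρ hf
      (fun j => (μ / lam j) • ContinuousLinearMap.fst ℝ _ (EuclideanSpace ℝ (Fin d)))
      ((μ / lam (Fin.last n)) • ContinuousLinearMap.fst ℝ _ _ -
        (|lam (Fin.last n)| / lam (Fin.last n)) • ContinuousLinearMap.snd ℝ _ _)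
    have h' := h.measurable
    refine AEStronglyMeasurable.congr ?_ ((ae_restrict_iff' measurableSet_Ioi).2 (.of_forall
      fun t (ht : 0 < t) => (scaleKernel_eq_smul_scaleProfile Ψ (fun j => Φ j) hlam ρ f ha.ne'
        hμ.ne' ht x z).symm))
    refine Measurable.aestronglyMeasurable ?_
    have h'' := fun u : EuclideanSpace ℝ (Fin d) × EuclideanSpace ℝ (Fin d) =>
      h'.comp (measurable_id.prodMk (measurable_inv.smul_const u) :
        Measurable fun t : ℝ => (t, t⁻¹ • u))
    exact ((by fun_prop : Measurable fun t : ℝ => (t ^ d)⁻¹).smul (h'' _)).const_smul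
      ((|lam (Fin.last n)| ^ d)⁻¹)

/-- The kernel estimate without measurability assumptions. -/
theorem exists_norm_iteratedFDeriv_modelKernel_le (hd : 0 < d)
    (Ψ : SchwartzMap (EuclideanSpace ℝ (Fin d)) ℂ)
    (Φ : Fin (n + 1) → SchwartzMap (EuclideanSpace ℝ (Fin d)) ℂ) {R : ℝ} (hR : 0 < R)
    (hΦ : ∀ j, ∀ ξ : EuclideanSpace ℝ (Fin d), R < ‖ξ‖ → 𝓕 (fun x => Φ j x) ξ = 0) (α β : ℕ) :
    ∃ C : ℝ, 0 ≤ C ∧ ∀ (lam ρ : Fin (n + 1) → ℝ), (∀ i, lam i ≠ 0) → |ρ (Fin.last n)| ≤ 1 →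
      ∀ μ, 0 < μ → (∀ i, μ ≤ |lam i|) →
      ∀ (L : ℝ → ℂ) (CL : ℝ), (∀ t, ‖L t‖ ≤ CL) →
      ∀ (f : Fin (n + 1) → EuclideanSpace ℝ (Fin d) → ℂ) (Fb : Fin (n + 1) → ℝ),
      (∀ j x, ‖f j x‖ ≤ Fb j) →
      ∀ x z, x ≠ z → ‖iteratedFDeriv ℝ β (fun z' => iteratedFDeriv ℝ α
          (fun x' => modelKernel d n Ψ (fun j => Φ j) L lam ρ f x' z') x) z‖ ≤
        C * (|lam (Fin.last n)| / μ) ^ α * (‖x - z‖ ^ (d + α + β))⁻¹ * CL *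
          ∏ j ∈ Finset.univ.erase (Fin.last n), Fb j := by
  obtain ⟨C, hC0, hC⟩ := exists_norm_iteratedFDeriv_kernel_le hd Ψ Φ α β
  refine ⟨C, hC0, fun lam ρ hlam hρ μ hμ hmin L CL hL f Fb hFb => ?_⟩
  have hCL : 0 ≤ CL := (norm_nonneg _).trans (hL 0)
  have hFb0 : ∀ j, 0 ≤ Fb j := fun j => (norm_nonneg _).trans (hFb j 0)
  by_cases hz : ∀ j ∈ Finset.univ.erase (Fin.last n),
      AEStronglyMeasurable (f j) volume ∧ Φ j ≠ 0
  · choose! g hgm hgB hfg using fun j hj =>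
      exists_measurable_ae_eq_norm_le (hz j hj).1 (hFb j) (hFb0 j)
    set g' : Fin (n + 1) → EuclideanSpace ℝ (Fin d) → ℂ := Function.update g (Fin.last n) 0
    have hgg : ∀ j ∈ Finset.univ.erase (Fin.last n), g' j = g j := fun j hj =>
      Function.update_of_ne (Finset.ne_of_mem_erase hj) _ _
    have hg'm : ∀ j ∈ Finset.univ.erase (Fin.last n), Measurable (g' j) := fun j hj => by
      rw [hgg j hj]
      exact hgm j hj
    have hg'B : ∀ j x, ‖g' j x‖ ≤ Fb j := fun j x => by
      by_cases hj : j = Fin.last n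
      · subst hj
        simpa [g'] using hFb0 (Fin.last n)
      · have hj' := Finset.mem_erase.2 ⟨hj, Finset.mem_univ j⟩
        rw [hgg j hj']
        exact hgB j hj' x
    rw [modelKernel_congr_convDil (g := g') Ψ (fun j => Φ j) L lam ρ fun j hj t ht x => by
      rw [hgg j hj]
      exact convDil_congr_ae _ _ (hfg j hj) x]
    obtain ⟨hkc, hkm⟩ := continuous_scaleKernel_and_measurable Ψ Φ hlam hρ hμ hmin hg'm hg'B
    obtain ⟨L', hL'm, hL'L, hL'⟩ := exists_aestronglyMeasurable_integral_eq_zero_or_eq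
      (μ := volume.restrict (Set.Ioi (0 : ℝ)))
      (k := fun t (p : EuclideanSpace ℝ (Fin d) × EuclideanSpace ℝ (Fin d)) =>
        scaleKernel Ψ (fun j => Φ j) lam ρ g' t p.1 p.2 / (t : ℂ))
      (fun p => ((hkm p.1 p.2).aemeasurable.div
        Complex.measurable_ofReal.aemeasurable).aestronglyMeasurable)
      ((ae_restrict_iff' measurableSet_Ioi).2 (.of_forall fun t ht => (hkc t ht).div_const _)) L
    refine hC lam ρ hlam hρ μ hμ hmin L' CL hL'm (fun t => (hL'L t).trans (hL t)) g' Fb hg'm hg'B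
      _ fun x z => ?_
    simpa only [modelKernel_eq_integral_scaleKernel, div_mul_eq_mul_div] using hL' (x, z)
  · push Not at hz
    obtain ⟨j, hj, hz⟩ := hz
    refine hC lam ρ hlam hρ μ hμ hmin 0 CL aestronglyMeasurable_zero (by simpa using hCL) 0 Fb
      (fun _ _ => measurable_const) (by simpa using hFb0) _ fun x z => .inl ?_
    refine modelKernel_eq_zero_of_convDil_eq_zero _ _ _ _ _ hj (fun t ht y => ?_) x z
    by_cases h0 : Φ j = 0
    · simp [h0, convDil, dil]
    · exact convDil_eq_zero_of_not_aestronglyMeasurable (Φ j).continuous.measurable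
        (ae_ne_zero_of_fourier_eq_zero (Φ j) hR (hΦ j) h0) (fun h => h0 (hz h))
        (mul_ne_zero (hlam j) ht.ne') y

end Kernel

/-- Calderón–Zygmund estimates for the kernel of the model operator, with a loss
`(|λ_n| / min_i |λ_i|)^{|α|}` in the `x`-derivatives; in particular uniform in `λ, ρ`
for `α = 0`. -/
theorem stmt_10 (d n : ℕ) (hd : 0 < d)
    (Ψ : SchwartzMap (EuclideanSpace ℝ (Fin d)) ℂ)
    (Φ : Fin (n + 1) → SchwartzMap (EuclideanSpace ℝ (Fin d)) ℂ)
    (c₁ c₂ : ℝ) (hc₁ : 0 < c₁) (hc₁₂ : c₁ < c₂)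
    (hΨ : ∀ ξ : EuclideanSpace ℝ (Fin d), ‖ξ‖ < c₁ ∨ c₂ < ‖ξ‖ → 𝓕 (fun x => Ψ x) ξ = 0)
    (R : ℝ) (hR : 0 < R)
    (hΦ : ∀ j, ∀ ξ : EuclideanSpace ℝ (Fin d), R < ‖ξ‖ → 𝓕 (fun x => Φ j x) ξ = 0)
    (α β : ℕ) :
    ∃ C : ℝ, 0 < C ∧
      ∀ (lam ρ : Fin (n + 1) → ℝ), (∀ i, lam i ≠ 0) →
        (∀ i, 0 < ρ i ∧ ρ i ≤ 1) →
        (∀ i, |lam i| ≤ |lam (Fin.last n)|) →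
        ∀ (L : ℝ → ℂ) (CL : ℝ), (∀ t, ‖L t‖ ≤ CL) →
        ∀ (f : Fin (n + 1) → EuclideanSpace ℝ (Fin d) → ℂ) (Fb : Fin (n + 1) → ℝ),
          (∀ j, ∀ x, ‖f j x‖ ≤ Fb j) →
        ∀ x z : EuclideanSpace ℝ (Fin d), x ≠ z →
          ‖iteratedFDeriv ℝ β
              (fun z' => iteratedFDeriv ℝ α
                (fun x' => modelKernel d n (fun w => Ψ w) (fun j w => Φ j w)
                  L lam ρ f x' z') x) z‖ ≤
            C * (|lam (Fin.last n)| /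
                  (Finset.univ.inf' Finset.univ_nonempty fun i => |lam i|)) ^ α *
              ‖x - z‖ ^ (-(d + α + β : ℝ)) * CL *
              ∏ j ∈ Finset.univ.erase (Fin.last n), Fb j := by
  obtain ⟨C, hC0, hC⟩ := exists_norm_iteratedFDeriv_modelKernel_le hd Ψ Φ hR hΦ α β
  refine ⟨C + 1, by positivity, fun lam ρ hlam hρ _ L CL hL f Fb hFb x z hxz => ?_⟩
  set μ := Finset.univ.inf' Finset.univ_nonempty fun i => |lam i| with hμ_def
  have hμ : 0 < μ := (Finset.lt_inf'_iff _).2 fun i _ => abs_pos.2 (hlam i)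
  have hρ' : |ρ (Fin.last n)| ≤ 1 := by
    rw [abs_of_pos (hρ _).1]
    exact (hρ _).2
  have hCL : 0 ≤ CL := (norm_nonneg _).trans (hL 0)
  have hP : 0 ≤ ∏ j ∈ Finset.univ.erase (Fin.last n), Fb j :=
    Finset.prod_nonneg fun j _ => (norm_nonneg _).trans (hFb j 0)
  refine (hC lam ρ hlam hρ' μ hμ (fun i => Finset.inf'_le _ (Finset.mem_univ i)) L CL hL f Fb hFb
    x z hxz).trans ?_
  have hpow : ‖x - z‖ ^ (-(d + α + β : ℝ)) = (‖x - z‖ ^ (d + α + β))⁻¹ := by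
    rw [Real.rpow_neg (norm_nonneg _), ← Real.rpow_natCast]
    push_cast
    rfl
  rw [hpow]
  gcongr
  exact le_add_of_nonneg_right zero_le_one
end

section
/- There exist Schwartz functions Ψ (with Fourier support in an annulus) and ζ (smooth, nonnegative, ∫ζ = 1) on ℝ such that the truncated bilinear operators U_{ε,λ}(f,g)(x) := ∫_ε^{1/ε} ∫_ℝ Ψ_t(y) (ζ_{λ₁t} ∗ f)(x − λ₁y)(ζ_{λ₂t} ∗ g)(x − λ₂y) dy dt/t do not admit bounds ‖U_{ε,λ}(f,g)‖_{L^p} ≤ C ‖f‖_{L^p}‖g‖_{L^∞} with C independent of ε > 0 and of λ₁, λ₂ ≠ 0, for any 1 < p < ∞. Indeed, for Schwartz f, g, the pointwise limit lim_{ε→0} lim_{λ₁→0} U_{ε,λ}(f,g)(x) equals f(x)·H(g)(x) for a suitable choice of Ψ, ζ realizing the Hilbert transform H, and a uniform bound would imply ‖f H(g)‖_p ≲ ‖f‖_p ‖g‖_∞, hence boundedness of the Hilbert transform on L^∞, a contradiction. -/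
open MeasureTheory
open scoped FourierTransform ENNReal NNReal

/-- L¹-normalized dilation on ℝ. -/
noncomputable def sc (g : ℝ → ℂ) (t x : ℝ) : ℂ := (|t|⁻¹ : ℝ) • g (t⁻¹ * x)

/-- Convolution with a dilated profile. -/
noncomputable def cnv (g : ℝ → ℂ) (t : ℝ) (f : ℝ → ℂ) (x : ℝ) : ℂ :=
  ∫ w, sc g t w * f (x - w)

/-- The truncated bilinear model operator on ℝ. -/
noncomputable def Utrunc (Ψ ζ : ℝ → ℂ) (ε lam₁ lam₂ : ℝ) (f g : ℝ → ℂ) (x : ℝ) : ℂ :=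
  ∫ t in Set.Ioo ε ε⁻¹,
    (∫ y, sc Ψ t y * cnv ζ (lam₁ * t) f (x - lam₁ * y) *
      cnv ζ (lam₂ * t) g (x - lam₂ * y)) / (t : ℂ)

open Filter Topology Set

/-- There is a Schwartz function, not vanishing at the origin, whose derivative has Fourier
support in the annulus `1 ≤ |ξ| ≤ 2`. -/
lemma exists_deriv_annular_fourier :
    ∃ Φ : SchwartzMap ℝ ℂ, 0 < (Φ 0).re ∧
      ∀ ξ : ℝ, |ξ| < 1 ∨ 2 < |ξ| → 𝓕 (fun x => SchwartzMap.derivCLM ℂ ℂ Φ x) ξ = 0 := by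
  let b : ContDiffBump (3 / 2 : ℝ) := ⟨1 / 4, 1 / 2, by norm_num, by norm_num⟩
  have hcs : HasCompactSupport (fun x => ((b x : ℝ) : ℂ)) :=
    b.hasCompactSupport.comp_left (g := fun r : ℝ => (r : ℂ)) (by simp)
  let k : SchwartzMap ℝ ℂ :=
    hcs.toSchwartzMap (Complex.ofRealCLM.contDiff.comp b.contDiff)
  have hk : ∀ x, k x = ((b x : ℝ) : ℂ) := fun x => rfl
  have hinv : 𝓕 ((𝓕⁻ k : SchwartzMap ℝ ℂ) : ℝ → ℂ) = k := by
    rw [← SchwartzMap.fourier_coe, FourierTransform.fourier_fourierInv_eq]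
  refine ⟨𝓕⁻ k, ?_, fun ξ hξ => ?_⟩
  · have : (𝓕⁻ k : SchwartzMap ℝ ℂ) 0 = ((∫ x, b x : ℝ) : ℂ) := by
      rw [SchwartzMap.fourierInv_coe, Real.fourierInv_eq']
      simp only [inner_zero_right, mul_zero, Complex.ofReal_zero, zero_mul, Complex.exp_zero,
        one_smul, hk]
      exact integral_ofReal
    rw [this, Complex.ofReal_re]
    exact b.integral_pos
  · have h := Real.fourier_deriv (f := ((𝓕⁻ k : SchwartzMap ℝ ℂ) : ℝ → ℂ))
      (SchwartzMap.integrable _) (SchwartzMap.differentiable _)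
      (SchwartzMap.integrable (SchwartzMap.derivCLM ℂ ℂ (𝓕⁻ k)))
    have h2 : 𝓕 (fun x => SchwartzMap.derivCLM ℂ ℂ (𝓕⁻ k) x) ξ
        = 𝓕 (deriv ((𝓕⁻ k : SchwartzMap ℝ ℂ) : ℝ → ℂ)) ξ := rfl
    simp only [h2, h, hinv, hk]
    rw [b.zero_of_le_dist, Complex.ofReal_zero, smul_zero]
    change 1 / 2 ≤ dist ξ (3 / 2)
    rw [Real.dist_eq, le_abs]
    rcases hξ with h | h
    · right; linarith [(abs_lt.1 h).2]
    · rcases lt_abs.1 h with h | h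
      · left; linarith
      · right; linarith

/-- A nonnegative Schwartz function of unit mass can be concentrated so close to the origin that
its pairing with a function of positive real part at the origin does not vanish. -/
lemma exists_approx_identity_pairing_ne_zero {Φ : ℝ → ℂ} (hΦ : Continuous Φ)
    (h0 : 0 < (Φ 0).re) :
    ∃ ζ : SchwartzMap ℝ ℝ, (∀ x, 0 ≤ ζ x) ∧ ∫ x, ζ x = 1 ∧
      ∫ v, (ζ v : ℂ) * Φ (-v) ≠ 0 := by
  have hc : Continuous fun v => (Φ (-v)).re := by fun_prop
  obtain ⟨r, hr, hball⟩ := Metric.eventually_nhds_iff_ball.1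
    (hc.continuousAt.eventually (lt_mem_nhds (a := 0) (by simpa using h0)) : ∀ᶠ v in 𝓝 (0 : ℝ), _)
  let b : ContDiffBump (0 : ℝ) := ⟨r / 2, r, by positivity, by linarith⟩
  let ζ : SchwartzMap ℝ ℝ :=
    (b.hasCompactSupport_normed (μ := volume)).toSchwartzMap (b.contDiff_normed)
  have hζ : ∀ x, ζ x = b.normed volume x := fun x => rfl
  refine ⟨ζ, fun x => b.nonneg_normed x, b.integral_normed, fun h => ?_⟩
  have hmul : Integrable fun v => (ζ v : ℂ) * Φ (-v) := by
    refine Continuous.integrable_of_hasCompactSupport (by fun_prop) ?_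
    exact ((b.hasCompactSupport_normed (μ := volume)).comp_left
      (g := fun r : ℝ => (r : ℂ)) (by simp)).mul_right
  have hre : ∫ v, ζ v * (Φ (-v)).re = 0 := by
    have := congrArg Complex.re h
    rw [← RCLike.re_eq_complex_re, ← integral_re hmul] at this
    simpa using this
  have hnn : ∀ v, 0 ≤ ζ v * (Φ (-v)).re := fun v => by
    by_cases hv : v ∈ Metric.ball 0 r
    · exact mul_nonneg (b.nonneg_normed v) (hball v hv).le
    · have : ζ v = 0 := by
        rw [hζ, ← Function.notMem_support, b.support_normed_eq]; exact hv
      simp [this]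
  have hcont : Continuous fun v => ζ v * (Φ (-v)).re := ζ.continuous.mul hc
  have hz := (hcont.integral_pos_of_hasCompactSupport_nonneg_nonzero (μ := volume)
    ((b.hasCompactSupport_normed (μ := volume)).mul_right) hnn (x := 0) ?_)
  · exact hz.ne' hre
  · have : ζ 0 ≠ 0 := by
      rw [hζ, ← Function.mem_support, b.support_normed_eq]; exact Metric.mem_ball_self hr
    exact mul_ne_zero this (by simpa using ne_of_gt h0)

/-- The average of `f` against the dilate of `ζ` of scale `s`, which also makes sense at `s = 0`. -/
noncomputable def dilatedAverage (ζ f : ℝ → ℂ) (s z : ℝ) : ℂ := ∫ v, ζ v * f (z - s * v)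

lemma integral_sc_mul (g h : ℝ → ℂ) {t : ℝ} (ht : t ≠ 0) :
    ∫ w, sc g t w * h w = ∫ v, g v * h (t * v) := by
  have := Measure.integral_comp_inv_mul_left (fun v => g v * h (t * v)) t
  rw [← inv_smul_eq_iff₀ (abs_ne_zero.2 ht), ← integral_smul] at this
  rw [← this]
  refine integral_congr_ae (.of_forall fun w => ?_)
  simp [sc, mul_inv_cancel_left₀ ht, mul_assoc]

lemma cnv_eq_dilatedAverage (ζ f : ℝ → ℂ) {s : ℝ} (hs : s ≠ 0) (z : ℝ) :
    cnv ζ s f z = dilatedAverage ζ f s z :=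
  integral_sc_mul ζ (fun w => f (z - w)) hs

lemma dilatedAverage_zero {ζ : ℝ → ℂ} (hζ : ∫ v, ζ v = 1) (f : ℝ → ℂ) (z : ℝ) :
    dilatedAverage ζ f 0 z = f z := by
  simp [dilatedAverage, integral_mul_const, hζ]

lemma norm_dilatedAverage_le {ζ f : ℝ → ℂ} {M : ℝ} (hζ : Integrable ζ) (hM : ∀ x, ‖f x‖ ≤ M)
    (s z : ℝ) : ‖dilatedAverage ζ f s z‖ ≤ (∫ v, ‖ζ v‖) * M := by
  rw [← integral_mul_const]
  refine norm_integral_le_of_norm_le (hζ.norm.mul_const M) (.of_forall fun v => ?_)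
  rw [norm_mul]
  exact mul_le_mul_of_nonneg_left (hM _) (norm_nonneg _)

lemma continuous_dilatedAverage {ζ f : ℝ → ℂ} {M : ℝ} (hζ : Integrable ζ) (hζc : Continuous ζ)
    (hf : Continuous f) (hM : ∀ x, ‖f x‖ ≤ M) :
    Continuous fun p : ℝ × ℝ => dilatedAverage ζ f p.1 p.2 := by
  refine continuous_of_dominated (bound := fun v => ‖ζ v‖ * M)
    (fun p => Continuous.aestronglyMeasurable (by fun_prop))
    (fun p => .of_forall fun v => ?_) (hζ.norm.mul_const M) (.of_forall fun v => by fun_prop)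
  rw [norm_mul]
  exact mul_le_mul_of_nonneg_left (hM _) (norm_nonneg _)

/-- The rescaled integrand of `Utrunc` with `lam₂ = 1`, which also makes sense for
`lam₁ = 0`. -/
noncomputable def scaleIntegrand (Ψ ζ f g : ℝ → ℂ) (lam x t : ℝ) : ℂ :=
  ∫ u, Ψ u * dilatedAverage ζ f (lam * t) (x - lam * (t * u)) * dilatedAverage ζ g t (x - t * u)

lemma Utrunc_eq_integral_scaleIntegrand (Ψ ζ f g : ℝ → ℂ) {ε lam : ℝ} (hε : 0 < ε)
    (hlam : lam ≠ 0) (x : ℝ) :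
    Utrunc Ψ ζ ε lam 1 f g x =
      ∫ t in Ioo ε ε⁻¹, scaleIntegrand Ψ ζ f g lam x t / (t : ℂ) := by
  refine setIntegral_congr_fun measurableSet_Ioo fun t ht => ?_
  have ht0 : t ≠ 0 := (hε.trans ht.1).ne'
  have h := integral_sc_mul Ψ
    (fun y => cnv ζ (lam * t) f (x - lam * y) * cnv ζ (1 * t) g (x - 1 * y)) ht0
  simp only [one_mul, cnv_eq_dilatedAverage ζ _ ht0,
    cnv_eq_dilatedAverage ζ _ (mul_ne_zero hlam ht0)] at h
  simp only [scaleIntegrand, one_mul, cnv_eq_dilatedAverage ζ _ ht0,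
    cnv_eq_dilatedAverage ζ _ (mul_ne_zero hlam ht0), mul_assoc (sc _ _ _), mul_assoc (Ψ _), h]

section Regularity

variable {Ψ ζ f g : ℝ → ℂ} {M N : ℝ}

lemma norm_scaleIntegrand_le (hΨ : Integrable Ψ) (hζ : Integrable ζ)
    (hM : ∀ x, ‖f x‖ ≤ M) (hN : ∀ x, ‖g x‖ ≤ N) (lam x t : ℝ) :
    ‖scaleIntegrand Ψ ζ f g lam x t‖ ≤
      (∫ u, ‖Ψ u‖) * ((∫ v, ‖ζ v‖) * M) * ((∫ v, ‖ζ v‖) * N) := by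
  rw [← integral_mul_const, ← integral_mul_const]
  refine norm_integral_le_of_norm_le ((hΨ.norm.mul_const _).mul_const _) (.of_forall fun v => ?_)
  rw [norm_mul, norm_mul]
  have h1 := norm_dilatedAverage_le hζ hM (lam * t) (x - lam * (t * v))
  have h2 := norm_dilatedAverage_le hζ hN t (x - t * v)
  have h3 := (norm_nonneg _).trans h1
  gcongr

lemma continuous_scaleIntegrand (hΨ : Integrable Ψ) (hΨc : Continuous Ψ)
    (hζ : Integrable ζ) (hζc : Continuous ζ) (hf : Continuous f) (hM : ∀ x, ‖f x‖ ≤ M)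
    (hg : Continuous g) (hN : ∀ x, ‖g x‖ ≤ N) :
    Continuous fun p : ℝ × ℝ × ℝ => scaleIntegrand Ψ ζ f g p.1 p.2.1 p.2.2 := by
  have hF := continuous_dilatedAverage hζ hζc hf hM
  have hG := continuous_dilatedAverage hζ hζc hg hN
  have hcont : Continuous fun q : (ℝ × ℝ × ℝ) × ℝ =>
      Ψ q.2 * dilatedAverage ζ f (q.1.1 * q.1.2.2) (q.1.2.1 - q.1.1 * (q.1.2.2 * q.2)) *
        dilatedAverage ζ g q.1.2.2 (q.1.2.1 - q.1.2.2 * q.2) := by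
    refine ((hΨc.comp continuous_snd).mul (hF.comp (g := fun p : ℝ × ℝ => _) (f := fun q :
      (ℝ × ℝ × ℝ) × ℝ => (q.1.1 * q.1.2.2, q.1.2.1 - q.1.1 * (q.1.2.2 * q.2))) ?_)).mul
      (hG.comp (g := fun p : ℝ × ℝ => _) (f := fun q :
      (ℝ × ℝ × ℝ) × ℝ => (q.1.2.2, q.1.2.1 - q.1.2.2 * q.2)) ?_) <;> fun_prop
  refine continuous_of_dominated
    (bound := fun u => ‖Ψ u‖ * ((∫ v, ‖ζ v‖) * M) * ((∫ v, ‖ζ v‖) * N))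
    (fun p => Continuous.aestronglyMeasurable ?_)
    (fun p => .of_forall fun v => ?_) ((hΨ.norm.mul_const _).mul_const _)
    (.of_forall fun v => ?_)
  · exact hcont.comp (g := fun q : (ℝ × ℝ × ℝ) × ℝ => _) (f := fun u => (p, u)) (by fun_prop)
  · rw [norm_mul, norm_mul]
    have h1 := norm_dilatedAverage_le hζ hM (p.1 * p.2.2) (p.2.1 - p.1 * (p.2.2 * v))
    have h2 := norm_dilatedAverage_le hζ hN p.2.2 (p.2.1 - p.2.2 * v)
    have h3 := (norm_nonneg _).trans h1
    gcongr
  · exact hcont.comp (g := fun q : (ℝ × ℝ × ℝ) × ℝ => _) (f := fun p => (p, v)) (by fun_prop)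

lemma continuous_integral_scaleIntegrand (hΨ : Integrable Ψ) (hΨc : Continuous Ψ)
    (hζ : Integrable ζ) (hζc : Continuous ζ) (hf : Continuous f) (hM : ∀ x, ‖f x‖ ≤ M)
    (hg : Continuous g) (hN : ∀ x, ‖g x‖ ≤ N) {ε : ℝ} (hε : 0 < ε) :
    Continuous fun p : ℝ × ℝ =>
      ∫ t in Ioo ε ε⁻¹, scaleIntegrand Ψ ζ f g p.1 p.2 t / (t : ℂ) := by
  have hB := continuous_scaleIntegrand hΨ hΨc hζ hζc hf hM hg hN
  set K := (∫ u, ‖Ψ u‖) * ((∫ v, ‖ζ v‖) * M) * ((∫ v, ‖ζ v‖) * N) with hK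
  refine continuous_of_dominated (bound := fun _ => K / ε) (fun p => ?_) (fun p => ?_)
    (integrable_const _) (.of_forall fun t => ?_)
  · refine ((hB.comp (g := fun q : ℝ × ℝ × ℝ => _) (f := fun t => (p.1, p.2, t))
      (by fun_prop)).measurable.div Complex.measurable_ofReal).aestronglyMeasurable
  · refine (ae_restrict_iff' measurableSet_Ioo).2 (.of_forall fun t ht => ?_)
    have h1 := norm_scaleIntegrand_le hΨ hζ hM hN p.1 p.2 t
    have h2 : 0 ≤ K := (norm_nonneg _).trans h1
    rw [norm_div, Complex.norm_real, Real.norm_of_nonneg (hε.trans ht.1).le]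
    have := ht.1.le
    gcongr
  · exact (hB.comp (g := fun q : ℝ × ℝ × ℝ => _) (f := fun p : ℝ × ℝ => (p.1, p.2, t))
      (by fun_prop)).div_const _

end Regularity

lemma scaleIntegrand_zero {Ψ ζ : ℝ → ℂ} (hζ : ∫ v, ζ v = 1) (f g : ℝ → ℂ) (x t : ℝ) :
    scaleIntegrand Ψ ζ f g 0 x t = f x * scaleIntegrand Ψ ζ 1 g 0 x t := by
  simp only [scaleIntegrand, zero_mul, sub_zero, dilatedAverage_zero hζ, Pi.one_apply,
    ← integral_const_mul]
  congr 1
  ext u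
  ring

lemma div_dilation_eq {𝕜 : Type*} [RCLike 𝕜] (g : ℝ → 𝕜) {s t : ℝ} (hs : s < 0) :
    g (-(t * s)) / (t : 𝕜) = ((-s : ℝ) : 𝕜) * (g (-s * t) / ((-s * t : ℝ) : 𝕜)) := by
  have : ((-s : ℝ) : 𝕜) ≠ 0 := by exact_mod_cast (neg_pos.2 hs).ne'
  rw [show -(t * s) = -s * t by ring, RCLike.ofReal_mul]
  rw [mul_div_assoc', mul_div_mul_left _ _ this]

section HalfLine

variable {𝕜 : Type*} [RCLike 𝕜] {g : ℝ → 𝕜}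

lemma integrableOn_dilation_div (hg0 : ∀ x ≤ 0, g x = 0)
    (hgi : IntegrableOn (fun x => g x / (x : 𝕜)) (Ioi 0)) (s : ℝ) :
    IntegrableOn (fun t : ℝ => g (-(t * s)) / (t : 𝕜)) (Ioi 0) := by
  rcases lt_or_ge s 0 with hs | hs
  · simp only [div_dilation_eq g hs]
    refine Integrable.const_mul ?_ _
    have := (integrableOn_Ioi_comp_mul_left_iff (fun x => g x / (x : 𝕜)) 0 (neg_pos.2 hs)).2
      (by simpa using hgi)
    exact this
  · refine (integrableOn_zero (ε' := 𝕜)).congr_fun (fun t ht => ?_) measurableSet_Ioi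
    have ht : 0 < t := ht
    simp [hg0 (-(t * s)) (neg_nonpos.2 (by positivity))]

lemma integral_dilation_div (hg0 : ∀ x ≤ 0, g x = 0) (s : ℝ) :
    ∫ t in Ioi 0, g (-(t * s)) / (t : 𝕜) =
      if s < 0 then ∫ x in Ioi 0, g x / (x : 𝕜) else 0 := by
  split_ifs with hs
  · simp only [div_dilation_eq g hs]
    rw [integral_const_mul, integral_comp_mul_left_Ioi (fun x => g x / (x : 𝕜)) 0 (neg_pos.2 hs),
      mul_zero, RCLike.real_smul_eq_coe_mul, ← mul_assoc, ← RCLike.ofReal_mul,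
      mul_inv_cancel₀ (neg_pos.2 hs).ne', RCLike.ofReal_one, one_mul]
  · refine (setIntegral_congr_fun measurableSet_Ioi fun t ht => ?_).trans (integral_zero _ _)
    have ht : 0 < t := ht
    have hs : 0 ≤ s := not_lt.1 hs
    simp [hg0 (-(t * s)) (neg_nonpos.2 (by positivity))]

end HalfLine

lemma iUnion_Ioo_inv_eq_Ioi :
    ⋃ n : ℕ, Ioo (1 / ((n : ℝ) + 2)) (1 / ((n : ℝ) + 2))⁻¹ = Ioi 0 := by
  ext x
  simp only [mem_iUnion, mem_Ioo, mem_Ioi, one_div, inv_inv]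
  refine ⟨fun ⟨n, h, _⟩ => lt_trans (by positivity) h, fun hx => ?_⟩
  obtain ⟨n, hn⟩ := exists_nat_gt (max x x⁻¹)
  refine ⟨n, ?_, ?_⟩
  · rw [inv_lt_comm₀ (by positivity) hx]
    linarith [le_max_right x x⁻¹]
  · linarith [le_max_left x x⁻¹]

lemma monotone_Ioo_inv :
    Monotone fun n : ℕ => Ioo (1 / ((n : ℝ) + 2)) (1 / ((n : ℝ) + 2))⁻¹ := by
  intro m n h
  have h' : (m : ℝ) ≤ n := by exact_mod_cast h
  refine Ioo_subset_Ioo ?_ ?_ <;> simp only [one_div, inv_inv]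
  · gcongr
  · gcongr

section Limit

variable {ζ g : ℝ → ℂ}

/-- The integrand over `t > 0` and `(u, v) ∈ ℝ²` whose integral is the formal limit of the
truncated operators at the origin. -/
noncomputable def limitIntegrand (Ψ ζ g : ℝ → ℂ) (t : ℝ) (p : ℝ × ℝ) : ℂ :=
  Ψ p.1 * ζ p.2 * (g (-(t * (p.1 + p.2))) / (t : ℂ))

lemma integrable_limitIntegrand {Ψ : ℝ → ℂ} (hΨ : Integrable Ψ) (hΨc : Continuous Ψ)
    (hζ : Integrable ζ) (hζc : Continuous ζ)
    (hg : Continuous g) (hg0 : ∀ x ≤ 0, g x = 0)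
    (hgi : IntegrableOn (fun x => g x / (x : ℂ)) (Ioi 0)) :
    Integrable (Function.uncurry (limitIntegrand Ψ ζ g))
      ((volume.restrict (Ioi 0)).prod (volume.prod volume)) := by
  have hm : Measurable (Function.uncurry (limitIntegrand Ψ ζ g)) := by
    refine Measurable.mul (Continuous.measurable (by fun_prop)) (Measurable.div ?_ ?_)
    · exact Continuous.measurable (by fun_prop)
    · exact Complex.measurable_ofReal.comp measurable_fst
  have hnorm : ∀ p : ℝ × ℝ, ∫ t in Ioi 0, ‖limitIntegrand Ψ ζ g t p‖ =
      ‖Ψ p.1 * ζ p.2‖ * if p.1 + p.2 < 0 then ∫ x in Ioi 0, ‖g x‖ / x else 0 := by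
    intro p
    have h := integral_dilation_div (𝕜 := ℝ) (g := fun x => ‖g x‖)
      (fun x hx => by simp [hg0 x hx]) (p.1 + p.2)
    simp only [RCLike.ofReal_real_eq_id, id] at h
    rw [← h, ← integral_const_mul]
    refine setIntegral_congr_fun measurableSet_Ioi fun t ht => ?_
    simp [limitIntegrand, abs_of_pos (show 0 < t from ht)]
  have hprod : Integrable (fun p : ℝ × ℝ => Ψ p.1 * ζ p.2) (volume.prod volume) := hΨ.mul_prod hζ
  refine (integrable_prod_iff' hm.aestronglyMeasurable).2 ⟨.of_forall fun p => ?_, ?_⟩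
  · exact (integrableOn_dilation_div hg0 hgi (p.1 + p.2)).const_mul (Ψ p.1 * ζ p.2)
  · simp only [Function.uncurry_apply_pair, hnorm]
    have hS : MeasurableSet {p : ℝ × ℝ | p.1 + p.2 < 0} :=
      measurableSet_lt (by fun_prop) (by fun_prop)
    refine hprod.norm.mul_bdd (c := |∫ x in Ioi 0, ‖g x‖ / x|) ?_ (.of_forall fun p => ?_)
    · exact (Measurable.ite hS measurable_const measurable_const).aestronglyMeasurable
    · split_ifs <;> simp

lemma tendsto_integral_scaleIntegrand (Φ : SchwartzMap ℝ ℂ)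
    (hζ : Integrable ζ) (hζc : Continuous ζ) (hζ1 : ∫ v, ζ v = 1)
    (hg : Continuous g) (hg0 : ∀ x ≤ 0, g x = 0)
    (hgi : IntegrableOn (fun x => g x / (x : ℂ)) (Ioi 0)) :
    Tendsto (fun n : ℕ => ∫ t in Ioo (1 / ((n : ℝ) + 2)) (1 / ((n : ℝ) + 2))⁻¹,
        scaleIntegrand (SchwartzMap.derivCLM ℂ ℂ Φ) ζ 1 g 0 0 t / (t : ℂ)) atTop
      (𝓝 ((∫ v, ζ v * Φ (-v)) * ∫ x in Ioi 0, g x / (x : ℂ))) := by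
  set Ψ := SchwartzMap.derivCLM ℂ ℂ Φ
  have hF := integrable_limitIntegrand Ψ.integrable Ψ.continuous hζ hζc hg hg0 hgi
  have hmarg : (fun t => ∫ p, limitIntegrand Ψ ζ g t p ∂(volume.prod volume))
      =ᵐ[volume.restrict (Ioi 0)] fun t => scaleIntegrand Ψ ζ 1 g 0 0 t / (t : ℂ) := by
    filter_upwards [hF.prod_right_ae] with t ht
    simp only [Function.uncurry_apply_pair] at ht
    rw [integral_prod _ ht, scaleIntegrand, ← integral_div]
    refine integral_congr_ae (.of_forall fun u => ?_)
    simp only [limitIntegrand, zero_mul, zero_sub, dilatedAverage_zero hζ1, Pi.one_apply, mul_one]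
    rw [dilatedAverage]
    rw [mul_div_assoc, ← integral_div, ← integral_const_mul]
    refine integral_congr_ae (.of_forall fun v => ?_)
    simp only [show -(t * u) - t * v = -(t * (u + v)) by ring]
    ring
  have hlim : ∫ t in Ioi 0, scaleIntegrand Ψ ζ 1 g 0 0 t / (t : ℂ) =
      (∫ v, ζ v * Φ (-v)) * ∫ x in Ioi 0, g x / (x : ℂ) := by
    have hF2 := hF.integral_prod_right
    rw [← integral_congr_ae hmarg, integral_integral_swap hF]
    simp only [Function.uncurry_apply_pair] at hF2
    have hin : ∀ p : ℝ × ℝ, ∫ t in Ioi 0, limitIntegrand Ψ ζ g t p =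
        Ψ p.1 * ζ p.2 * if p.1 + p.2 < 0 then ∫ x in Ioi 0, g x / (x : ℂ) else 0 := fun p =>
      (integral_const_mul _ _).trans
        (congrArg (Ψ p.1 * ζ p.2 * ·) (integral_dilation_div hg0 (p.1 + p.2)))
    simp only [hin] at hF2 ⊢
    rw [integral_prod_symm _ hF2, ← integral_mul_const]
    refine integral_congr_ae (.of_forall fun v => ?_)
    have hΦ : ∫ u in Iic (-v), Ψ u = Φ (-v) := by
      have := integral_Iic_of_hasDerivAt_of_tendsto' (f := Φ) (f' := Ψ) (a := -v) (m := 0)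
        (fun x _ => Φ.differentiableAt.hasDerivAt) Ψ.integrable.integrableOn
        (Φ.tendsto_cocompact.mono_left atBot_le_cocompact)
      simpa using this
    beta_reduce
    generalize ∫ x in Ioi 0, g x / (x : ℂ) = G
    rw [← hΦ, integral_Iic_eq_integral_Iio, ← integral_indicator measurableSet_Iio,
      ← integral_const_mul, ← integral_mul_const]
    refine integral_congr_ae (.of_forall fun u => ?_)
    simp only [indicator_apply, mem_Iio, ← lt_neg_iff_add_neg]
    split_ifs <;> ring
  rw [← hlim, ← iUnion_Ioo_inv_eq_Ioi]
  refine tendsto_setIntegral_of_monotone (fun n => measurableSet_Ioo) monotone_Ioo_inv ?_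
  rw [iUnion_Ioo_inv_eq_Ioi]
  exact hF.integral_prod_left.congr hmarg

end Limit

/-- Schwartz functions bounded by one whose Hilbert transform at the origin is as large as
desired. -/
lemma exists_schwartz_large_integral_div (L : ℝ) :
    ∃ g : SchwartzMap ℝ ℂ, (∀ x, ‖g x‖ ≤ 1) ∧ (∀ x ≤ 0, g x = 0) ∧
      IntegrableOn (fun x => g x / (x : ℂ)) (Ioi 0) ∧
      L ≤ ‖∫ x in Ioi 0, g x / (x : ℂ)‖ := by
  set δ : ℝ := Real.exp (-(|L| + 1)) with hδ
  have hδ0 : 0 < δ := Real.exp_pos _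
  have hδ1 : δ < 1 := by rw [hδ, Real.exp_lt_one_iff]; linarith [abs_nonneg L]
  let b : ContDiffBump (1 : ℝ) := ⟨1 - δ, 1 - δ / 2, by linarith, by linarith⟩
  have hcs : HasCompactSupport (fun x => ((b x : ℝ) : ℂ)) :=
    b.hasCompactSupport.comp_left (g := fun r : ℝ => (r : ℂ)) (by simp)
  let g : SchwartzMap ℝ ℂ :=
    hcs.toSchwartzMap (Complex.ofRealCLM.contDiff.comp b.contDiff)
  have hg : ∀ x, g x = ((b x : ℝ) : ℂ) := fun x => rfl
  have hb0 : ∀ x ≤ δ / 2, b x = 0 := fun x hx => by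
    refine b.zero_of_le_dist ?_
    change 1 - δ / 2 ≤ dist x 1
    rw [Real.dist_eq, le_abs]
    right; linarith
  have hb1 : ∀ x ∈ Ioc δ 1, b x = 1 := fun x hx => by
    refine b.one_of_mem_closedBall ?_
    change dist x 1 ≤ 1 - δ
    rw [Real.dist_eq, abs_le]
    constructor <;> linarith [hx.1, hx.2]
  have hbi : IntegrableOn (fun x => b x / x) (Ioi 0) := by
    refine ((b.integrable (μ := volume)).mul_const (2 / δ)).integrableOn.mono'
      (b.continuous.measurable.div measurable_id).aestronglyMeasurable
      (.of_forall fun x => ?_)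
    rcases le_or_gt x (δ / 2) with hx | hx
    · simp [hb0 x hx]
    · have hx0 : 0 < x := by linarith
      rw [Real.norm_of_nonneg (div_nonneg b.nonneg hx0.le), div_eq_mul_inv,
        ← inv_div δ 2]
      exact mul_le_mul_of_nonneg_left (inv_anti₀ (by positivity) hx.le) b.nonneg
  have hgb : (fun x => g x / (x : ℂ)) = fun x => ((b x / x : ℝ) : ℂ) := by
    ext x; simp [hg]
  refine ⟨g, fun x => ?_, fun x hx => ?_, ?_, ?_⟩
  · rw [hg, Complex.norm_real, Real.norm_of_nonneg b.nonneg]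
    exact b.le_one
  · rw [hg, hb0 x (by linarith), Complex.ofReal_zero]
  · rw [hgb]; exact Integrable.ofReal hbi
  · rw [hgb, integral_complex_ofReal, Complex.norm_real]
    refine le_trans ?_ (le_abs_self _)
    have hlog : ∫ x in Ioc δ 1, b x / x = |L| + 1 := by
      rw [setIntegral_congr_fun (g := fun x => 1 / x) measurableSet_Ioc
        (fun x hx => by simp only [hb1 x hx]), ← intervalIntegral.integral_of_le hδ1.le,
        integral_one_div_of_pos hδ0 one_pos, one_div, Real.log_inv, hδ, Real.log_exp, neg_neg]
    have hle : ∫ x in Ioc δ 1, b x / x ≤ ∫ x in Ioi 0, b x / x := by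
      refine setIntegral_mono_set hbi ?_ (LE.le.eventuallyLE fun x hx => hδ0.trans hx.1)
      exact (ae_restrict_iff' measurableSet_Ioi).2
        (.of_forall fun x hx => div_nonneg b.nonneg (le_of_lt hx))
    linarith [le_abs_self L]

/-- If multiplication by a continuous function `V` is bounded on `Lᵖ` by `C`, tested on Schwartz
functions, then `V` is bounded by `C`. -/
lemma norm_le_of_eLpNorm_mul_le {V : ℝ → ℂ} (hV : Continuous V) {p : ℝ≥0∞} (hp : p ≠ 0)
    {C : ℝ} (hC : 0 ≤ C)
    (h : ∀ f : SchwartzMap ℝ ℂ, eLpNorm (fun x => f x * V x) p volume ≤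
      ENNReal.ofReal C * eLpNorm (fun x => f x) p volume) (x₀ : ℝ) : ‖V x₀‖ ≤ C := by
  by_contra! hlt
  obtain ⟨K, hCK, hK⟩ := exists_between hlt
  obtain ⟨r, hr, hball⟩ := Metric.eventually_nhds_iff_ball.1
    (hV.norm.continuousAt.eventually (lt_mem_nhds hK))
  let b : ContDiffBump x₀ := ⟨r / 2, r, by positivity, by linarith⟩
  have hcs : HasCompactSupport (fun x => ((b x : ℝ) : ℂ)) :=
    b.hasCompactSupport.comp_left (g := fun r : ℝ => (r : ℂ)) (by simp)
  let f : SchwartzMap ℝ ℂ :=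
    hcs.toSchwartzMap (Complex.ofRealCLM.contDiff.comp b.contDiff)
  have hf : ∀ x, f x = ((b x : ℝ) : ℂ) := fun x => rfl
  have hlow : ENNReal.ofReal K * eLpNorm (fun x => f x) p volume ≤
      eLpNorm (fun x => f x * V x) p volume := by
    have hK0 : 0 ≤ K := hC.trans hCK.le
    have : eLpNorm (K • fun x => f x) p volume ≤ eLpNorm (fun x => f x * V x) p volume := by
      refine eLpNorm_mono fun x => ?_
      rw [Pi.smul_apply, norm_smul, norm_mul, Real.norm_of_nonneg hK0, mul_comm]
      by_cases hx : x ∈ Metric.ball x₀ r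
      · exact mul_le_mul_of_nonneg_left (hball x hx).le (norm_nonneg _)
      · rw [hf, b.zero_of_le_dist (not_lt.1 hx)]
        simp
    rwa [eLpNorm_const_smul, Real.enorm_of_nonneg hK0] at this
  have hfin : eLpNorm (fun x => f x) p volume ≠ ⊤ := (f.memLp p volume).2.ne
  have hne : eLpNorm (fun x => f x) p volume ≠ 0 := fun h0 => by
    rw [eLpNorm_eq_zero_iff f.continuous.aestronglyMeasurable hp] at h0
    have h1 := congrFun ((Continuous.ae_eq_iff_eq volume f.continuous continuous_zero).1 h0) x₀
    rw [hf, b.one_of_mem_closedBall (Metric.mem_closedBall_self (by positivity))] at h1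
    simp at h1
  have := (ENNReal.mul_le_mul_iff_left hne hfin).1 (hlow.trans (h f))
  exact absurd ((ENNReal.ofReal_le_ofReal_iff hC).1 this) (not_le.2 hCK)

/-- Letting `lam₁ → 0` in a uniform bound for the truncated operators. -/
lemma eLpNorm_mul_integral_scaleIntegrand_le {Ψ ζ g : ℝ → ℂ} {N ε : ℝ} {p D : ℝ≥0∞}
    (hΨ : Integrable Ψ) (hΨc : Continuous Ψ)
    (hζ : Integrable ζ) (hζc : Continuous ζ) (hζ1 : ∫ v, ζ v = 1)
    (hg : Continuous g) (hN : ∀ x, ‖g x‖ ≤ N) (hε : 0 < ε) (f : SchwartzMap ℝ ℂ)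
    (h : ∀ lam : ℝ, lam ≠ 0 → eLpNorm (Utrunc Ψ ζ ε lam 1 (fun x => f x) g) p volume ≤ D) :
    eLpNorm (fun x => f x * ∫ t in Ioo ε ε⁻¹, scaleIntegrand Ψ ζ 1 g 0 x t / (t : ℂ)) p volume
      ≤ D := by
  have hcont := continuous_integral_scaleIntegrand hΨ hΨc hζ hζc f.continuous
    (fun x => f.toBoundedContinuousFunction.norm_coe_le_norm x) hg hN hε
  set W : ℝ → ℝ → ℂ := fun lam x =>
    ∫ t in Ioo ε ε⁻¹, scaleIntegrand Ψ ζ (fun x => f x) g lam x t / (t : ℂ) with hW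
  have hWc : Continuous fun p : ℝ × ℝ => W p.1 p.2 := hcont
  have h0 : (fun x => f x * ∫ t in Ioo ε ε⁻¹, scaleIntegrand Ψ ζ 1 g 0 x t / (t : ℂ)) = W 0 := by
    ext x
    rw [hW, ← integral_const_mul]
    refine integral_congr_ae (.of_forall fun t => ?_)
    simp only [scaleIntegrand_zero hζ1 (fun x => f x) g, mul_div_assoc]
  rw [h0]
  have hbound : ∀ n : ℕ, eLpNorm (W (1 / ((n : ℝ) + 1))) p volume ≤ D := fun n => by
    have hn : (1 / ((n : ℝ) + 1)) ≠ 0 := by positivity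
    convert h _ hn using 2
    ext x
    rw [Utrunc_eq_integral_scaleIntegrand _ _ _ _ hε hn]
  refine (Lp.eLpNorm_lim_le_liminf_eLpNorm (f := fun n : ℕ => W (1 / ((n : ℝ) + 1)))
    (fun n => ?_) _ (.of_forall fun x => ?_)).trans ?_
  · exact (hWc.comp (g := fun p : ℝ × ℝ => _) (f := fun x => (1 / ((n : ℝ) + 1), x))
      (by fun_prop)).aestronglyMeasurable
  · have : Continuous fun lam => W lam x :=
      hWc.comp (g := fun p : ℝ × ℝ => _) (f := fun lam => (lam, x)) (by fun_prop)
    exact (this.tendsto 0).comp tendsto_one_div_add_atTop_nhds_zero_nat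
  · exact liminf_le_of_le (by isBoundedDefault) fun b hb => by
      obtain ⟨n, hn⟩ := hb.exists
      exact hn.trans (hbound n)

/-- Negative result: there are admissible profiles `Ψ` (annular Fourier support) and `ζ`
(nonnegative, unit mass) for which no bound
`‖U_{ε,λ}(f,g)‖_p ≤ C ‖f‖_p ‖g‖_∞` can hold with `C` independent of `ε` and `λ₁, λ₂`. -/
theorem stmt_11 :
    ∃ (Ψ : SchwartzMap ℝ ℂ) (ζ : SchwartzMap ℝ ℝ),
      (∃ c₁ c₂ : ℝ, 0 < c₁ ∧ c₁ < c₂ ∧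
        ∀ ξ : ℝ, |ξ| < c₁ ∨ c₂ < |ξ| → 𝓕 (fun x => Ψ x) ξ = 0) ∧
      (∀ x, 0 ≤ ζ x) ∧ (∫ x, ζ x = 1) ∧
      ∀ p : ℝ, 1 < p →
        ¬ ∃ C : ℝ, 0 < C ∧
          ∀ (ε : ℝ), 0 < ε → ε < 1 →
          ∀ (lam₁ lam₂ : ℝ), lam₁ ≠ 0 → lam₂ ≠ 0 →
          ∀ (f g : SchwartzMap ℝ ℂ),
            eLpNorm
                (Utrunc (fun x => Ψ x) (fun x => (ζ x : ℂ)) ε lam₁ lam₂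
                  (fun x => f x) (fun x => g x))
                (ENNReal.ofReal p) volume ≤
              ENNReal.ofReal C * eLpNorm (fun x => f x) (ENNReal.ofReal p) volume *
                eLpNorm (fun x => g x) ⊤ volume := by
  obtain ⟨Φ, hΦ0, hΦ⟩ := exists_deriv_annular_fourier
  obtain ⟨ζ, hζ0, hζ1, hζΦ⟩ := exists_approx_identity_pairing_ne_zero Φ.continuous hΦ0
  refine ⟨SchwartzMap.derivCLM ℂ ℂ Φ, ζ, ⟨1, 2, one_pos, one_lt_two, hΦ⟩, hζ0, hζ1, ?_⟩
  rintro p hp ⟨C, hC, H⟩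
  set Ψ := SchwartzMap.derivCLM ℂ ℂ Φ
  set ζc : ℝ → ℂ := fun x => (ζ x : ℂ)
  have hζi : Integrable ζc := Integrable.ofReal ζ.integrable
  have hζcont : Continuous ζc := Complex.continuous_ofReal.comp ζ.continuous
  have hζc1 : ∫ v, ζc v = 1 := by
    rw [integral_complex_ofReal, hζ1, Complex.ofReal_one]
  have hc : 0 < ‖∫ v, ζc v * Φ (-v)‖ := norm_pos_iff.2 hζΦ
  obtain ⟨g, hg1, hg0, hgi, hgL⟩ :=
    exists_schwartz_large_integral_div ((C + 1) / ‖∫ v, ζc v * Φ (-v)‖)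
  have hgtop : eLpNorm (fun x => g x) ⊤ volume ≤ 1 := by
    rw [eLpNorm_exponent_top]
    simpa using eLpNormEssSup_le_of_ae_bound (f := fun x => g x) (μ := volume) (.of_forall hg1)
  have hlim := (tendsto_integral_scaleIntegrand Φ hζi hζcont hζc1 g.continuous hg0 hgi).norm
  have hle : ‖(∫ v, ζc v * Φ (-v)) * ∫ x in Ioi 0, g x / (x : ℂ)‖ ≤ C := by
    refine le_of_tendsto' hlim fun n => ?_
    have hε : 0 < 1 / ((n : ℝ) + 2) := by positivity
    have hε1 : 1 / ((n : ℝ) + 2) < 1 := by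
      rw [div_lt_one (by positivity)]
      linarith [(Nat.cast_nonneg n : (0 : ℝ) ≤ n)]
    have hV := (continuous_integral_scaleIntegrand (f := 1) (M := 1) Ψ.integrable Ψ.continuous
      hζi hζcont continuous_one (fun x => by simp) g.continuous hg1 hε).comp
      (g := fun p : ℝ × ℝ => _) (f := fun x => (0, x)) (by fun_prop)
    refine norm_le_of_eLpNorm_mul_le hV (p := ENNReal.ofReal p)
      (by rw [Ne, ENNReal.ofReal_eq_zero]; linarith) hC.le (fun f => ?_) 0
    refine eLpNorm_mul_integral_scaleIntegrand_le Ψ.integrable Ψ.continuous hζi hζcont hζc1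
      g.continuous hg1 hε f fun lam hlam => ?_
    refine (H _ hε hε1 lam 1 hlam one_ne_zero f g).trans ?_
    exact mul_le_of_le_one_right' hgtop
  rw [norm_mul] at hle
  rw [div_le_iff₀' hc] at hgL
  linarith
end
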